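/- arXiv:1105.3792 — 10 statements merged into one kernel-verified Lean document; each statement's English description precedes it below -/
import Mathlib

section
/- Let G be the presented group on generators D₁, D₂, g₁, g₂, b with relations g₁² = 1, g₂² = 1, g₁g₂ = g₂g₁, g₁D₁g₁⁻¹ = D₁⁻¹, g₁D₂g₁⁻¹ = D₂⁻¹, g₂D₁g₂⁻¹ = D₂⁻¹, b² = 1, bg₁ = g₁b, bg₂ = g₂b, bD₁ = D₁b, bD₂ = D₂b. Then the images of D₁ and D₂ in G freely generate a free subgroup of rank 2; that is, the homomorphism from the free group on two generators to G sending the generators to (the images of) D₁ and D₂ is injective. -/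
namespace Stmt0

/-- Generators: `0 ↦ D₁`, `1 ↦ D₂`, `2 ↦ g₁`, `3 ↦ g₂`, `4 ↦ b`. -/
def D₁ : FreeGroup (Fin 5) := FreeGroup.of 0
def D₂ : FreeGroup (Fin 5) := FreeGroup.of 1
def g₁ : FreeGroup (Fin 5) := FreeGroup.of 2
def g₂ : FreeGroup (Fin 5) := FreeGroup.of 3
def b : FreeGroup (Fin 5) := FreeGroup.of 4

/-- The relators of the presentation of Lemma 3.1(1). -/
def rels : Set (FreeGroup (Fin 5)) :=
  {g₁ ^ 2, g₂ ^ 2, g₁ * g₂ * (g₂ * g₁)⁻¹,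
   g₁ * D₁ * g₁⁻¹ * D₁, g₁ * D₂ * g₁⁻¹ * D₂, g₂ * D₁ * g₂⁻¹ * D₂,
   b ^ 2, b * g₁ * (g₁ * b)⁻¹, b * g₂ * (g₂ * b)⁻¹,
   b * D₁ * (D₁ * b)⁻¹, b * D₂ * (D₂ * b)⁻¹}

/-- The involutive automorphism of the free group of rank 2 that inverts both letters after
permuting them by `σ`. -/
def permInv (σ : Equiv.Perm (Fin 2)) (hσ : ∀ i, σ (σ i) = i) : MulAut (FreeGroup (Fin 2)) :=
  MonoidHom.toMulEquiv (FreeGroup.lift fun i => (FreeGroup.of (σ i))⁻¹)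
    (FreeGroup.lift fun i => (FreeGroup.of (σ i))⁻¹)
    (by ext i; simp [hσ]) (by ext i; simp [hσ])

@[simp]
theorem permInv_of (σ : Equiv.Perm (Fin 2)) (hσ : ∀ i, σ (σ i) = i) (i : Fin 2) :
    permInv σ hσ (FreeGroup.of i) = (FreeGroup.of (σ i))⁻¹ := by
  simp [permInv]

theorem mulAut_freeGroup_ext {α : Type*} {f g : MulAut (FreeGroup α)}
    (h : ∀ i, f (FreeGroup.of i) = g (FreeGroup.of i)) : f = g :=
  MulEquiv.toMonoidHom_injective (FreeGroup.ext_hom _ _ h)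

theorem permInv_sq (σ : Equiv.Perm (Fin 2)) (hσ : ∀ i, σ (σ i) = i) :
    permInv σ hσ ^ 2 = 1 :=
  mulAut_freeGroup_ext fun i => by simp [pow_two, hσ]

/-- The automorphism inverting both letters. -/
def invAut : MulAut (FreeGroup (Fin 2)) := permInv 1 (by simp)

/-- The automorphism sending each letter to the inverse of the other one. -/
def swapInvAut : MulAut (FreeGroup (Fin 2)) := permInv (Equiv.swap 0 1) (by simp)

@[simp]
theorem invAut_of (i : Fin 2) : invAut (FreeGroup.of i) = (FreeGroup.of i)⁻¹ :=
  permInv_of 1 _ i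

@[simp]
theorem swapInvAut_of (i : Fin 2) :
    swapInvAut (FreeGroup.of i) = (FreeGroup.of (Equiv.swap 0 1 i))⁻¹ :=
  permInv_of _ _ i

theorem invAut_sq : invAut ^ 2 = 1 := permInv_sq _ _

theorem swapInvAut_sq : swapInvAut ^ 2 = 1 := permInv_sq _ _

theorem invAut_mul_swapInvAut : invAut * swapInvAut = swapInvAut * invAut :=
  mulAut_freeGroup_ext fun i => by simp

/-- The holomorph of the free group of rank 2. -/
abbrev Holomorph : Type :=
  FreeGroup (Fin 2) ⋊[MonoidHom.id (MulAut (FreeGroup (Fin 2)))] MulAut (FreeGroup (Fin 2))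

/-- The images of the five generators in the holomorph. -/
def genImage : Fin 5 → Holomorph :=
  ![SemidirectProduct.inl (FreeGroup.of 0), SemidirectProduct.inl (FreeGroup.of 1),
    SemidirectProduct.inr invAut, SemidirectProduct.inr swapInvAut, 1]

theorem inr_mul_inl_mul_inr_inv (f : MulAut (FreeGroup (Fin 2))) (w : FreeGroup (Fin 2)) :
    (SemidirectProduct.inr f * SemidirectProduct.inl w * (SemidirectProduct.inr f)⁻¹ :
      Holomorph) = SemidirectProduct.inl (f w) := by
  rw [← map_inv]
  exact (SemidirectProduct.inl_aut f w).symm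

theorem lift_genImage_eq_one : ∀ r ∈ rels, FreeGroup.lift genImage r = 1 := by
  have hcomm : (SemidirectProduct.inr invAut * SemidirectProduct.inr swapInvAut : Holomorph) =
      SemidirectProduct.inr swapInvAut * SemidirectProduct.inr invAut := by
    rw [← map_mul, invAut_mul_swapInvAut, map_mul]
  rintro r (rfl | rfl | rfl | rfl | rfl | rfl | rfl | rfl | rfl | rfl | rfl) <;>
    simp only [D₁, D₂, g₁, g₂, b, map_mul, map_inv, map_pow, FreeGroup.lift_apply_of,
      genImage, Matrix.cons_val, inr_mul_inl_mul_inr_inv, one_pow, one_mul, mul_one,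
      mul_inv_cancel]
  · rw [← map_pow, invAut_sq, map_one]
  · rw [← map_pow, swapInvAut_sq, map_one]
  · rw [hcomm, mul_inv_cancel]
  all_goals simp

/-- The homomorphism from the presented group to the holomorph. -/
def toHolomorph : PresentedGroup rels →* Holomorph :=
  PresentedGroup.toGroup lift_genImage_eq_one

/-- The images of `D₁` and `D₂` in the presented group freely generate a free
subgroup of rank 2. -/
theorem D₁_D₂_freely_generate :
    Function.Injective
      (FreeGroup.lift
          ![(PresentedGroup.of 0 : PresentedGroup rels), PresentedGroup.of 1] :
        FreeGroup (Fin 2) →* PresentedGroup rels) := by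
  have hinl : toHolomorph.comp
      (FreeGroup.lift ![(PresentedGroup.of 0 : PresentedGroup rels), PresentedGroup.of 1]) =
      SemidirectProduct.inl := by
    refine FreeGroup.ext_hom _ _ fun i => ?_
    fin_cases i <;> simp [toHolomorph, genImage]
  refine Function.Injective.of_comp (f := toHolomorph) ?_
  rw [← MonoidHom.coe_comp, hinl]
  exact SemidirectProduct.inl_injective

end Stmt0
end

section
/- Let G be the presented group on generators D₁, D₂, g₁, g₂, b with relations g₁² = 1, g₂² = 1, g₁g₂ = g₂g₁, g₁D₁g₁⁻¹ = D₁⁻¹, g₁D₂g₁⁻¹ = D₂⁻¹, g₂D₁g₂⁻¹ = D₂⁻¹, b² = 1, bg₁ = g₁b, bg₂ = g₂b, bD₁ = D₁b, bD₂ = D₂b. Let V₄ = ℤ/2 × ℤ/2 act on the free group F₂ on generators x, y by letting (1,0) act by the automorphism ι (ι(x) = x⁻¹, ι(y) = y⁻¹) and (0,1) act by the automorphism θ (θ(x) = y⁻¹, θ(y) = x⁻¹). Then G is isomorphic to the direct product ℤ/2 × (F₂ ⋊ V₄), via an isomorphism carrying b to the generator of the ℤ/2 factor, D₁ to x, D₂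 to y, g₁ to (1,0) ∈ V₄, and g₂ to (0,1) ∈ V₄. -/
namespace Stmt1

/-- Generators: `0 ↦ D₁`, `1 ↦ D₂`, `2 ↦ g₁`, `3 ↦ g₂`, `4 ↦ b`. -/
def D₁ : FreeGroup (Fin 5) := FreeGroup.of 0
def D₂ : FreeGroup (Fin 5) := FreeGroup.of 1
def g₁ : FreeGroup (Fin 5) := FreeGroup.of 2
def g₂ : FreeGroup (Fin 5) := FreeGroup.of 3
def b : FreeGroup (Fin 5) := FreeGroup.of 4

/-- The relators of the presentation of Lemma 3.1(1). -/
def rels : Set (FreeGroup (Fin 5)) :=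
  {g₁ ^ 2, g₂ ^ 2, g₁ * g₂ * (g₂ * g₁)⁻¹,
   g₁ * D₁ * g₁⁻¹ * D₁, g₁ * D₂ * g₁⁻¹ * D₂, g₂ * D₁ * g₂⁻¹ * D₂,
   b ^ 2, b * g₁ * (g₁ * b)⁻¹, b * g₂ * (g₂ * b)⁻¹,
   b * D₁ * (D₁ * b)⁻¹, b * D₂ * (D₂ * b)⁻¹}

/-- The Klein four-group `V₄ = ℤ/2 × ℤ/2` (written multiplicatively). -/
abbrev V₄ := Multiplicative (ZMod 2 × ZMod 2)

/-- The free group `F₂` on two generators `x = of 0` and `y = of 1`. -/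
abbrev F₂ := FreeGroup (Fin 2)

/-- The homomorphism from the cyclic group of order two determined by an element `g`
with `g ^ 2 = 1`. -/
def zmodTwoHom {G : Type*} [Group G] (g : G) (hg : g ^ 2 = 1) : Multiplicative (ZMod 2) →* G where
  toFun a := g ^ a.toAdd.val
  map_one' := by simp
  map_mul' a c := by
    rw [toAdd_mul, ZMod.val_add, ← pow_add]
    exact (pow_eq_pow_mod _ hg).symm

@[simp]
lemma zmodTwoHom_ofAdd_one {G : Type*} [Group G] (g : G) (hg : g ^ 2 = 1) :
    zmodTwoHom g hg (Multiplicative.ofAdd 1) = g :=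
  pow_one g

lemma zmodTwo_hom_ext {G : Type*} [Group G] {f f' : Multiplicative (ZMod 2) →* G}
    (h : f (Multiplicative.ofAdd 1) = f' (Multiplicative.ofAdd 1)) : f = f' := by
  refine MonoidHom.ext fun a => ?_
  obtain rfl | rfl : a = 1 ∨ a = Multiplicative.ofAdd 1 := by
    revert a
    exact (by decide : ∀ a : Multiplicative (ZMod 2), a = 1 ∨ a = Multiplicative.ofAdd 1)
  · rw [map_one, map_one]
  · exact h

/-- Two homomorphisms out of a product are equal if they agree on both factors. -/
lemma prod_hom_ext {G M N : Type*} [Group G] [Group M] [Group N] {f f' : M × N →* G}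
    (hl : f.comp (MonoidHom.inl M N) = f'.comp (MonoidHom.inl M N))
    (hr : f.comp (MonoidHom.inr M N) = f'.comp (MonoidHom.inr M N)) : f = f' := by
  rw [← f.noncommCoprod_unique, ← f'.noncommCoprod_unique]
  simp only [hl, hr]

lemma V₄_cases (v : V₄) :
    v = 1 ∨ v = Multiplicative.ofAdd (1, 0) ∨ v = Multiplicative.ofAdd (0, 1) ∨
      v = Multiplicative.ofAdd (1, 0) * Multiplicative.ofAdd (0, 1) := by
  revert v; decide

/-- The homomorphism from the Klein four-group determined by two commuting elements
`g`, `h` with `g ^ 2 = 1` and `h ^ 2 = 1`. -/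
def kleinFourHom {G : Type*} [Group G] (g h : G) (hg : g ^ 2 = 1) (hh : h ^ 2 = 1)
    (hgh : Commute g h) : V₄ →* G :=
  ((zmodTwoHom g hg).noncommCoprod (zmodTwoHom h hh) fun _ _ => hgh.pow_pow _ _).comp
    (MulEquiv.prodMultiplicative (ZMod 2) (ZMod 2)).toMonoidHom

@[simp]
lemma kleinFourHom_ofAdd_one_zero {G : Type*} [Group G] (g h : G) (hg : g ^ 2 = 1)
    (hh : h ^ 2 = 1) (hgh : Commute g h) :
    kleinFourHom g h hg hh hgh (Multiplicative.ofAdd (1, 0)) = g := by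
  change g ^ 1 * h ^ 0 = g
  simp

@[simp]
lemma kleinFourHom_ofAdd_zero_one {G : Type*} [Group G] (g h : G) (hg : g ^ 2 = 1)
    (hh : h ^ 2 = 1) (hgh : Commute g h) :
    kleinFourHom g h hg hh hgh (Multiplicative.ofAdd (0, 1)) = h := by
  change g ^ 0 * h ^ 1 = h
  simp

lemma V₄_hom_ext {G : Type*} [Group G] {f f' : V₄ →* G}
    (h₁ : f (Multiplicative.ofAdd (1, 0)) = f' (Multiplicative.ofAdd (1, 0)))
    (h₂ : f (Multiplicative.ofAdd (0, 1)) = f' (Multiplicative.ofAdd (0, 1))) : f = f' := by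
  refine MonoidHom.ext fun v => ?_
  obtain rfl | rfl | rfl | rfl := V₄_cases v
  · rw [map_one, map_one]
  · exact h₁
  · exact h₂
  · rw [map_mul, map_mul, h₁, h₂]

/-- Equivariance of a homomorphism from a group with a `V₄`-action need only be checked on the
two standard generators of `V₄`. -/
lemma equivariant_of_generators {G N : Type*} [Group G] [Group N] (φ : V₄ →* MulAut N)
    (f : N →* G) (k : V₄ →* G)
    (h₁ : ∀ n, f (φ (Multiplicative.ofAdd (1, 0)) n) =
      k (Multiplicative.ofAdd (1, 0)) * f n * (k (Multiplicative.ofAdd (1, 0)))⁻¹)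
    (h₂ : ∀ n, f (φ (Multiplicative.ofAdd (0, 1)) n) =
      k (Multiplicative.ofAdd (0, 1)) * f n * (k (Multiplicative.ofAdd (0, 1)))⁻¹) (v : V₄) :
    f.comp (φ v).toMonoidHom = (MulAut.conj (k v)).toMonoidHom.comp f := by
  ext n
  change f (φ v n) = k v * f n * (k v)⁻¹
  obtain rfl | rfl | rfl | rfl := V₄_cases v
  · rw [map_one, map_one, MulAut.one_apply, one_mul, inv_one, mul_one]
  · exact h₁ n
  · exact h₂ n
  · rw [map_mul, map_mul, MulAut.mul_apply, h₁, h₂]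
    group

/-- The presented group is isomorphic to `ℤ/2 × (F₂ ⋊ V₄)`, where `(1,0) ∈ V₄`
acts on `F₂` by `ι` (inverting both generators) and `(0,1) ∈ V₄` acts by `θ`
(`x ↦ y⁻¹`, `y ↦ x⁻¹`); the isomorphism carries `b` to the generator of the
`ℤ/2` factor, `D₁` to `x`, `D₂` to `y`, `g₁` to `(1,0)` and `g₂` to `(0,1)`. -/
theorem structure_of_presented_group
    (φ : V₄ →* MulAut F₂)
    (hι₀ : φ (Multiplicative.ofAdd (1, 0)) (FreeGroup.of 0) = (FreeGroup.of 0)⁻¹)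
    (hι₁ : φ (Multiplicative.ofAdd (1, 0)) (FreeGroup.of 1) = (FreeGroup.of 1)⁻¹)
    (hθ₀ : φ (Multiplicative.ofAdd (0, 1)) (FreeGroup.of 0) = (FreeGroup.of 1)⁻¹)
    (hθ₁ : φ (Multiplicative.ofAdd (0, 1)) (FreeGroup.of 1) = (FreeGroup.of 0)⁻¹) :
    ∃ e : PresentedGroup rels ≃* Multiplicative (ZMod 2) × (F₂ ⋊[φ] V₄),
      e (PresentedGroup.of 4) = (Multiplicative.ofAdd 1, 1) ∧
      e (PresentedGroup.of 0) = (1, SemidirectProduct.inl (FreeGroup.of 0)) ∧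
      e (PresentedGroup.of 1) = (1, SemidirectProduct.inl (FreeGroup.of 1)) ∧
      e (PresentedGroup.of 2) = (1, SemidirectProduct.inr (Multiplicative.ofAdd (1, 0))) ∧
      e (PresentedGroup.of 3) = (1, SemidirectProduct.inr (Multiplicative.ofAdd (0, 1))) := by
  let img : Fin 5 → Multiplicative (ZMod 2) × (F₂ ⋊[φ] V₄) :=
    ![(1, SemidirectProduct.inl (FreeGroup.of 0)), (1, SemidirectProduct.inl (FreeGroup.of 1)),
      (1, SemidirectProduct.inr (Multiplicative.ofAdd (1, 0))),
      (1, SemidirectProduct.inr (Multiplicative.ofAdd (0, 1))), (Multiplicative.ofAdd 1, 1)]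
  have himg : ∀ r ∈ rels, FreeGroup.lift img r = 1 := by
    have hb : (Multiplicative.ofAdd 1 : Multiplicative (ZMod 2)) ^ 2 = 1 := by decide
    have hs : (Multiplicative.ofAdd (1, 0) : V₄) ^ 2 = 1 := by decide
    have ht : (Multiplicative.ofAdd (0, 1) : V₄) ^ 2 = 1 := by decide
    have hst : (SemidirectProduct.inr (Multiplicative.ofAdd (1, 0)) : F₂ ⋊[φ] V₄) *
        SemidirectProduct.inr (Multiplicative.ofAdd (0, 1)) =
        SemidirectProduct.inr (Multiplicative.ofAdd (0, 1)) *
        SemidirectProduct.inr (Multiplicative.ofAdd (1, 0)) := by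
      rw [← map_mul, mul_comm, map_mul]
    have hconj (v : V₄) (n : F₂) : (SemidirectProduct.inr v : F₂ ⋊[φ] V₄) *
        SemidirectProduct.inl n * (SemidirectProduct.inr v)⁻¹ = SemidirectProduct.inl (φ v n) := by
      rw [SemidirectProduct.inl_aut, map_inv]
    simp only [rels, Set.mem_insert_iff, Set.mem_singleton_iff]
    rintro r (rfl | rfl | rfl | rfl | rfl | rfl | rfl | rfl | rfl | rfl | rfl) <;>
      simp only [D₁, D₂, g₁, g₂, b, map_mul, map_inv, map_pow, FreeGroup.lift_apply_of] <;>
      simp [img, Prod.ext_iff, ← map_pow, hb, hs, ht, hst, hconj, hι₀, hι₁, hθ₀]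
  have hrel {r : FreeGroup (Fin 5)} (hr : r ∈ rels) : PresentedGroup.mk rels r = 1 :=
    PresentedGroup.one_of_mem hr
  let P : Fin 5 → PresentedGroup rels := PresentedGroup.of
  have hg₁ : P 2 ^ 2 = 1 := hrel (r := g₁ ^ 2) (by simp [rels])
  have hg₂ : P 3 ^ 2 = 1 := hrel (r := g₂ ^ 2) (by simp [rels])
  have hb : P 4 ^ 2 = 1 := hrel (r := b ^ 2) (by simp [rels])
  have hg₁g₂ : Commute (P 2) (P 3) :=
    mul_inv_eq_one.1 (hrel (r := g₁ * g₂ * (g₂ * g₁)⁻¹) (by simp [rels]))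
  have hg₁D₁ : P 2 * P 0 * (P 2)⁻¹ = (P 0)⁻¹ :=
    mul_eq_one_iff_eq_inv.1 (hrel (r := g₁ * D₁ * g₁⁻¹ * D₁) (by simp [rels]))
  have hg₁D₂ : P 2 * P 1 * (P 2)⁻¹ = (P 1)⁻¹ :=
    mul_eq_one_iff_eq_inv.1 (hrel (r := g₁ * D₂ * g₁⁻¹ * D₂) (by simp [rels]))
  have hg₂D₁ : P 3 * P 0 * (P 3)⁻¹ = (P 1)⁻¹ :=
    mul_eq_one_iff_eq_inv.1 (hrel (r := g₂ * D₁ * g₂⁻¹ * D₂) (by simp [rels]))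
  have hg₂D₂ : P 3 * P 1 * (P 3)⁻¹ = (P 0)⁻¹ := by
    have hinv : (P 3)⁻¹ = P 3 := inv_eq_of_mul_eq_one_left (by rw [← sq, hg₂])
    rw [← inv_inj, conj_inv, ← hg₂D₁, hinv, inv_inv]
    calc P 3 * (P 3 * P 0 * P 3) * P 3 = P 3 ^ 2 * P 0 * P 3 ^ 2 := by simp only [sq, mul_assoc]
      _ = P 0 := by rw [hg₂, one_mul, mul_one]
  have hbg₁ : Commute (P 4) (P 2) :=
    mul_inv_eq_one.1 (hrel (r := b * g₁ * (g₁ * b)⁻¹) (by simp [rels]))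
  have hbg₂ : Commute (P 4) (P 3) :=
    mul_inv_eq_one.1 (hrel (r := b * g₂ * (g₂ * b)⁻¹) (by simp [rels]))
  have hbD₁ : Commute (P 4) (P 0) :=
    mul_inv_eq_one.1 (hrel (r := b * D₁ * (D₁ * b)⁻¹) (by simp [rels]))
  have hbD₂ : Commute (P 4) (P 1) :=
    mul_inv_eq_one.1 (hrel (r := b * D₂ * (D₂ * b)⁻¹) (by simp [rels]))
  have hb_central (x : PresentedGroup rels) : Commute (P 4) x := by
    suffices h : MonoidHom.id _ = (MulAut.conj (P 4)).toMonoidHom by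
      exact (mul_inv_eq_iff_eq_mul.1 (DFunLike.congr_fun h x).symm)
    refine PresentedGroup.ext fun i => ?_
    refine (mul_inv_eq_iff_eq_mul.2 (?_ : Commute (P 4) (P i))).symm
    fin_cases i
    exacts [hbD₁, hbD₂, hbg₁, hbg₂, Commute.refl _]
  let f : F₂ →* PresentedGroup rels := FreeGroup.lift ![P 0, P 1]
  let k : V₄ →* PresentedGroup rels := kleinFourHom (P 2) (P 3) hg₁ hg₂ hg₁g₂
  have equivariant_of_basis (v : V₄)
      (h₀ : f (φ v (FreeGroup.of 0)) = k v * P 0 * (k v)⁻¹)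
      (h₁ : f (φ v (FreeGroup.of 1)) = k v * P 1 * (k v)⁻¹) (n : F₂) :
      f (φ v n) = k v * f n * (k v)⁻¹ := by
    suffices h : f.comp (φ v).toMonoidHom = (MulAut.conj (k v)).toMonoidHom.comp f from
      DFunLike.congr_fun h n
    ext i
    fin_cases i
    · simpa [f] using h₀
    · simpa [f] using h₁
  have hfk (v : V₄) : f.comp (φ v).toMonoidHom = (MulAut.conj (k v)).toMonoidHom.comp f := by
    refine equivariant_of_generators φ f k (equivariant_of_basis _ ?_ ?_)
      (equivariant_of_basis _ ?_ ?_) v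
    · simp [hι₀, f, k, hg₁D₁]
    · simp [hι₁, f, k, hg₁D₂]
    · simp [hθ₀, f, k, hg₂D₁]
    · simp [hθ₁, f, k, hg₂D₂]
  let toProd := PresentedGroup.toGroup himg
  let ofProd : Multiplicative (ZMod 2) × (F₂ ⋊[φ] V₄) →* PresentedGroup rels :=
    (zmodTwoHom (P 4) hb).noncommCoprod (SemidirectProduct.lift f k hfk)
      fun _ _ => (hb_central _).pow_left _
  have ofProd_apply (c : Multiplicative (ZMod 2)) (x : F₂ ⋊[φ] V₄) :
      ofProd (c, x) = zmodTwoHom (P 4) hb c * SemidirectProduct.lift f k hfk x := rfl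
  have toProd_of (i : Fin 5) : toProd (PresentedGroup.of i) = img i := PresentedGroup.toGroup.of himg
  refine ⟨toProd.toMulEquiv ofProd ?_ ?_, toProd_of 4, toProd_of 0, toProd_of 1, toProd_of 2,
    toProd_of 3⟩
  · refine PresentedGroup.ext fun i => ?_
    rw [MonoidHom.comp_apply, toProd_of]
    change ofProd (img i) = P i
    fin_cases i <;> simp [img, ofProd_apply, f, k]
  · have toProd_P (i : Fin 5) : toProd (P i) = img i := toProd_of i
    refine prod_hom_ext ?_ ?_
    · refine zmodTwo_hom_ext ?_
      simp [ofProd_apply, toProd_P, img]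
    · refine SemidirectProduct.hom_ext ?_ ?_
      · ext i : 1
        fin_cases i <;> simp [ofProd_apply, f, toProd_P, img]
      · refine V₄_hom_ext ?_ ?_ <;> simp [ofProd_apply, k, toProd_P, img]

end Stmt1
end

section
/- Let G be the presented group on generators D₁', D₂', h₁, h₂, a with relations h₁² = 1, h₂² = 1, h₁h₂ = h₂h₁, h₁D₁'h₁⁻¹ = D₁'⁻¹, h₁D₂'h₁⁻¹ = D₂'⁻¹, h₂D₁'h₂⁻¹ = D₂'⁻¹, h₁ah₁⁻¹ = a, h₂ah₂⁻¹ = a⁻¹, D₁'aD₁'⁻¹ = a, D₂'aD₂'⁻¹ = a. Then the images of D₁' and D₂' in G freely generate a free subgroup of rank 2; that is, the homomorphism from the free group on two generators to G sending the generators to (the images of) D₁' and D₂' is injective. -/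
namespace Stmt2

/-- Generators: `0 ↦ D₁'`, `1 ↦ D₂'`, `2 ↦ h₁`, `3 ↦ h₂`, `4 ↦ a`. -/
def D₁' : FreeGroup (Fin 5) := FreeGroup.of 0
def D₂' : FreeGroup (Fin 5) := FreeGroup.of 1
def h₁ : FreeGroup (Fin 5) := FreeGroup.of 2
def h₂ : FreeGroup (Fin 5) := FreeGroup.of 3
def a : FreeGroup (Fin 5) := FreeGroup.of 4

/-- The relators of the presentation of Lemma 3.1(2). -/
def rels : Set (FreeGroup (Fin 5)) :=
  {h₁ ^ 2, h₂ ^ 2, h₁ * h₂ * (h₂ * h₁)⁻¹,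
   h₁ * D₁' * h₁⁻¹ * D₁', h₁ * D₂' * h₁⁻¹ * D₂', h₂ * D₁' * h₂⁻¹ * D₂',
   h₁ * a * h₁⁻¹ * a⁻¹, h₂ * a * h₂⁻¹ * a,
   D₁' * a * D₁'⁻¹ * a⁻¹, D₂' * a * D₂'⁻¹ * a⁻¹}

/-- The endomorphism of the free group of rank 2 inverting both generators. -/
def invGenerators : FreeGroup (Fin 2) →* FreeGroup (Fin 2) :=
  FreeGroup.lift fun i => (FreeGroup.of i)⁻¹

/-- The endomorphism of the free group of rank 2 sending each generator to the inverse of the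
other one. -/
def swapInvGenerators : FreeGroup (Fin 2) →* FreeGroup (Fin 2) :=
  FreeGroup.lift fun i => (FreeGroup.of (1 - i))⁻¹

theorem invGenerators_involutive : Function.Involutive invGenerators := by
  have h : invGenerators.comp invGenerators = MonoidHom.id _ := by
    ext i; simp [invGenerators]
  exact DFunLike.congr_fun h

theorem swapInvGenerators_involutive : Function.Involutive swapInvGenerators := by
  have h : swapInvGenerators.comp swapInvGenerators = MonoidHom.id _ := by
    ext i; simp [swapInvGenerators]
  exact DFunLike.congr_fun h

theorem invGenerators_swapInvGenerators (x : FreeGroup (Fin 2)) :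
    invGenerators (swapInvGenerators x) = swapInvGenerators (invGenerators x) := by
  have h : invGenerators.comp swapInvGenerators = swapInvGenerators.comp invGenerators := by
    ext i; simp [invGenerators, swapInvGenerators]
  exact DFunLike.congr_fun h x

/-- Permutations of the free group of rank 2 satisfying the relations: the `Dᵢ'` act by left
multiplication, the `hᵢ` by automorphisms and `a` trivially. -/
def genPerm : Fin 5 → Equiv.Perm (FreeGroup (Fin 2)) :=
  ![Equiv.mulLeft (FreeGroup.of 0), Equiv.mulLeft (FreeGroup.of 1),
    invGenerators_involutive.toPerm, swapInvGenerators_involutive.toPerm, 1]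

theorem lift_genPerm_of_mem_rels (r : FreeGroup (Fin 5)) (hr : r ∈ rels) :
    FreeGroup.lift genPerm r = 1 := by
  have h_inv : invGenerators_involutive.toPerm⁻¹ = invGenerators_involutive.toPerm := rfl
  have h_swap : swapInvGenerators_involutive.toPerm⁻¹ = swapInvGenerators_involutive.toPerm := rfl
  have h_inv_of (i) : invGenerators (FreeGroup.of i) = (FreeGroup.of i)⁻¹ := by
    simp [invGenerators]
  have h_swap_of (i) : swapInvGenerators (FreeGroup.of i) = (FreeGroup.of (1 - i))⁻¹ := by
    simp [swapInvGenerators]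
  simp only [rels, Set.mem_insert_iff, Set.mem_singleton_iff] at hr
  rcases hr with rfl | rfl | rfl | rfl | rfl | rfl | rfl | rfl | rfl | rfl <;>
  · ext1 x
    simp [D₁', D₂', h₁, h₂, a, genPerm, pow_two, h_inv, h_swap, h_inv_of, h_swap_of,
      invGenerators_involutive _, swapInvGenerators_involutive _,
      invGenerators_swapInvGenerators]

/-- The images of `D₁'` and `D₂'` in the presented group freely generate a free
subgroup of rank 2. -/
theorem D₁'_D₂'_freely_generate :
    Function.Injective
      (FreeGroup.lift
          ![(PresentedGroup.of 0 : PresentedGroup rels), PresentedGroup.of 1] :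
        FreeGroup (Fin 2) →* PresentedGroup rels) := by
  have h : (PresentedGroup.toGroup lift_genPerm_of_mem_rels).comp
      (FreeGroup.lift ![(PresentedGroup.of 0 : PresentedGroup rels), PresentedGroup.of 1]) =
      MulAction.toPermHom (FreeGroup (Fin 2)) (FreeGroup (Fin 2)) := by
    ext i : 1
    fin_cases i <;> ext1 x <;> simp [genPerm]
  refine Function.Injective.of_comp
    (f := PresentedGroup.toGroup lift_genPerm_of_mem_rels) ?_
  rw [← MonoidHom.coe_comp, h]
  exact MulAction.toPerm_injective

end Stmt2
end

section
/- Let G be the presented group on generators D₁', D₂', h₁, h₂, a with relations h₁² = 1, h₂² = 1, h₁h₂ = h₂h₁, h₁D₁'h₁⁻¹ = D₁'⁻¹, h₁D₂'h₁⁻¹ = D₂'⁻¹, h₂D₁'h₂⁻¹ = D₂'⁻¹, h₁ah₁⁻¹ = a, h₂ah₂⁻¹ = a⁻¹, D₁'aD₁'⁻¹ = a, D₂'aD₂'⁻¹ = a. Let V₄ = ℤ/2 × ℤ/2 act on the free group F₂ on generators x, y by letting (1,0) act by the automorphism ι (ι(x) = x⁻¹, ι(y) = y⁻¹) and (0,1)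 act by the automorphism θ (θ(x) = y⁻¹, θ(y) = x⁻¹), and let Q = F₂ ⋊ V₄. Let Q act on ℤ by letting an element act trivially if the second ℤ/2-coordinate of its V₄-component is trivial, and by negation otherwise. Then G is isomorphic to the semidirect product ℤ ⋊ Q, via an isomorphism carrying a to the generator 1 of ℤ, D₁' to x, D₂' to y, h₁ to (1,0) ∈ V₄, and h₂ to (0,1) ∈ V₄. In particular, the image of a in G has infinite order. -/
namespace Stmt3

/-- Generators: `0 ↦ D₁'`, `1 ↦ D₂'`, `2 ↦ h₁`, `3 ↦ h₂`, `4 ↦ a`. -/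
def D₁' : FreeGroup (Fin 5) := FreeGroup.of 0
def D₂' : FreeGroup (Fin 5) := FreeGroup.of 1
def h₁ : FreeGroup (Fin 5) := FreeGroup.of 2
def h₂ : FreeGroup (Fin 5) := FreeGroup.of 3
def a : FreeGroup (Fin 5) := FreeGroup.of 4

/-- The relators of the presentation of Lemma 3.1(2). -/
def rels : Set (FreeGroup (Fin 5)) :=
  {h₁ ^ 2, h₂ ^ 2, h₁ * h₂ * (h₂ * h₁)⁻¹,
   h₁ * D₁' * h₁⁻¹ * D₁', h₁ * D₂' * h₁⁻¹ * D₂', h₂ * D₁' * h₂⁻¹ * D₂',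
   h₁ * a * h₁⁻¹ * a⁻¹, h₂ * a * h₂⁻¹ * a,
   D₁' * a * D₁'⁻¹ * a⁻¹, D₂' * a * D₂'⁻¹ * a⁻¹}

/-- The Klein four-group `V₄ = ℤ/2 × ℤ/2` (written multiplicatively). -/
abbrev V₄ := Multiplicative (ZMod 2 × ZMod 2)

/-- The free group `F₂` on two generators `x = of 0` and `y = of 1`. -/
abbrev F₂ := FreeGroup (Fin 2)

section Helpers

/-- Two commuting involutions of a group determine a homomorphism from `V₄`. -/
def kleinLift {G : Type*} [Group G] (g h : G) (hg : g ^ 2 = 1) (hh : h ^ 2 = 1)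
    (hgh : Commute g h) : V₄ →* G where
  toFun v := g ^ (Multiplicative.toAdd v).1.val * h ^ (Multiplicative.toAdd v).2.val
  map_one' := by simp
  map_mul' v w := by
    have key {k : G} (hk : k ^ 2 = 1) (i j : ZMod 2) :
        k ^ (i + j).val = k ^ i.val * k ^ j.val := by
      rw [ZMod.val_add, ← pow_add, ← pow_eq_pow_mod _ hk]
    simp only [toAdd_mul, Prod.fst_add, Prod.snd_add, key hg, key hh]
    exact (hgh.pow_pow _ _).mul_mul_mul_comm _ _

@[simp]
theorem kleinLift_fst {G : Type*} [Group G] (g h : G) (hg : g ^ 2 = 1) (hh : h ^ 2 = 1)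
    (hgh : Commute g h) : kleinLift g h hg hh hgh (Multiplicative.ofAdd (1, 0)) = g := by
  simp [kleinLift, ZMod.val_one]

@[simp]
theorem kleinLift_snd {G : Type*} [Group G] (g h : G) (hg : g ^ 2 = 1) (hh : h ^ 2 = 1)
    (hgh : Commute g h) : kleinLift g h hg hh hgh (Multiplicative.ofAdd (0, 1)) = h := by
  simp [kleinLift, ZMod.val_one]

theorem klein_subgroup_eq_top {S : Subgroup V₄} (h₁ : Multiplicative.ofAdd (1, 0) ∈ S)
    (h₂ : Multiplicative.ofAdd (0, 1) ∈ S) : S = ⊤ := by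
  refine (Subgroup.eq_top_iff' S).2 fun v => ?_
  have hv : v = Multiplicative.ofAdd (1, 0) ^ (Multiplicative.toAdd v).1.val *
      Multiplicative.ofAdd (0, 1) ^ (Multiplicative.toAdd v).2.val := by
    revert v; decide
  rw [hv]
  exact mul_mem (pow_mem h₁ _) (pow_mem h₂ _)

theorem klein_hom_ext {G : Type*} [Group G] {f g : V₄ →* G}
    (h₁ : f (Multiplicative.ofAdd (1, 0)) = g (Multiplicative.ofAdd (1, 0)))
    (h₂ : f (Multiplicative.ofAdd (0, 1)) = g (Multiplicative.ofAdd (0, 1))) : f = g :=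
  MonoidHom.eq_of_eqOn_top fun v _ => by
    have : v ∈ f.eqLocus g := by
      rw [klein_subgroup_eq_top (S := f.eqLocus g) h₁ h₂]
      trivial
    exact this

/-- The elements of `G` at which `f` intertwines the action `φ` with conjugation through `k`. -/
def equivariantSubgroup {N G H : Type*} [Group N] [Group G] [Group H] (φ : G →* MulAut N)
    (f : N →* H) (k : G →* H) : Subgroup G where
  carrier := {g | f.comp (φ g).toMonoidHom = (MulAut.conj (k g)).toMonoidHom.comp f}
  one_mem' := by
    ext n
    simp
  mul_mem' {g g'} hg hg' := by
    ext n
    have h₁ := DFunLike.congr_fun hg (φ g' n)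
    have h₂ := DFunLike.congr_fun hg' n
    simp at h₁ h₂
    simp [h₁, h₂, mul_assoc]
  inv_mem' {g} hg := by
    ext n
    have h := DFunLike.congr_fun hg ((φ g)⁻¹ n)
    simp at h
    simp [h, mul_assoc]

theorem mem_equivariantSubgroup {N G H : Type*} [Group N] [Group G] [Group H]
    {φ : G →* MulAut N} {f : N →* H} {k : G →* H} {g : G} :
    g ∈ equivariantSubgroup φ f k ↔
      f.comp (φ g).toMonoidHom = (MulAut.conj (k g)).toMonoidHom.comp f :=
  Iff.rfl

theorem equivariant_of_eq_top {N G H : Type*} [Group N] [Group G] [Group H]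
    {φ : G →* MulAut N} {f : N →* H} {k : G →* H} (h : equivariantSubgroup φ f k = ⊤) (g : G) :
    f.comp (φ g).toMonoidHom = (MulAut.conj (k g)).toMonoidHom.comp f :=
  mem_equivariantSubgroup.1 (h ▸ Subgroup.mem_top g)

theorem semidirect_subgroup_eq_top {φ : V₄ →* MulAut F₂} {S : Subgroup (F₂ ⋊[φ] V₄)}
    (hx : SemidirectProduct.inl (FreeGroup.of 0) ∈ S)
    (hy : SemidirectProduct.inl (FreeGroup.of 1) ∈ S)
    (h₁ : SemidirectProduct.inr (Multiplicative.ofAdd (1, 0)) ∈ S)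
    (h₂ : SemidirectProduct.inr (Multiplicative.ofAdd (0, 1)) ∈ S) : S = ⊤ := by
  have hF : S.comap SemidirectProduct.inl = ⊤ := by
    rw [← top_le_iff, ← FreeGroup.closure_range_of, Subgroup.closure_le]
    rintro _ ⟨i, rfl⟩
    fin_cases i
    exacts [hx, hy]
  have hV : S.comap SemidirectProduct.inr = ⊤ := klein_subgroup_eq_top h₁ h₂
  refine (Subgroup.eq_top_iff' S).2 fun q => ?_
  rw [← SemidirectProduct.inl_left_mul_inr_right q]
  exact mul_mem ((Subgroup.eq_top_iff' _).1 hF q.left) ((Subgroup.eq_top_iff' _).1 hV q.right)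

theorem exists_hom_of_relations {H : Type*} [Group H] {φ : V₄ →* MulAut F₂}
    (hι₀ : φ (Multiplicative.ofAdd (1, 0)) (FreeGroup.of 0) = (FreeGroup.of 0)⁻¹)
    (hι₁ : φ (Multiplicative.ofAdd (1, 0)) (FreeGroup.of 1) = (FreeGroup.of 1)⁻¹)
    (hθ₀ : φ (Multiplicative.ofAdd (0, 1)) (FreeGroup.of 0) = (FreeGroup.of 1)⁻¹)
    (hθ₁ : φ (Multiplicative.ofAdd (0, 1)) (FreeGroup.of 1) = (FreeGroup.of 0)⁻¹)
    {ψ : (F₂ ⋊[φ] V₄) →* MulAut (Multiplicative ℤ)}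
    (hψ : ∀ (q : F₂ ⋊[φ] V₄) (z : Multiplicative ℤ),
      ψ q z = if (Multiplicative.toAdd q.right).2 = 0 then z else z⁻¹)
    {d e g h t : H} (hg : g ^ 2 = 1) (hh : h ^ 2 = 1) (hgh : Commute g h)
    (hgd : g * d * g⁻¹ = d⁻¹) (hge : g * e * g⁻¹ = e⁻¹) (hhd : h * d * h⁻¹ = e⁻¹)
    (hgt : g * t * g⁻¹ = t) (hht : h * t * h⁻¹ = t⁻¹)
    (hdt : d * t * d⁻¹ = t) (het : e * t * e⁻¹ = t) :
    ∃ f : Multiplicative ℤ ⋊[ψ] (F₂ ⋊[φ] V₄) →* H,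
      f (SemidirectProduct.inl (Multiplicative.ofAdd 1)) = t ∧
      f (SemidirectProduct.inr (SemidirectProduct.inl (FreeGroup.of 0))) = d ∧
      f (SemidirectProduct.inr (SemidirectProduct.inl (FreeGroup.of 1))) = e ∧
      f (SemidirectProduct.inr (SemidirectProduct.inr (Multiplicative.ofAdd (1, 0)))) = g ∧
      f (SemidirectProduct.inr (SemidirectProduct.inr (Multiplicative.ofAdd (0, 1)))) = h := by
  have hhe : h * e * h⁻¹ = d⁻¹ := by
    have hinv : h⁻¹ = h := inv_eq_of_mul_eq_one_left (by rw [← sq, hh])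
    have he : e = h * d⁻¹ * h⁻¹ := by rw [← conj_inv, hhd, inv_inv]
    rw [he, hinv, mul_assoc, mul_assoc, mul_assoc, ← sq, hh, mul_one, ← mul_assoc, ← sq, hh,
      one_mul]
  have hQ : equivariantSubgroup φ (FreeGroup.lift ![d, e]) (kleinLift g h hg hh hgh) = ⊤ := by
    apply klein_subgroup_eq_top <;> rw [mem_equivariantSubgroup] <;> ext i <;> fin_cases i
    · simp [hι₀, hgd]
    · simp [hι₁, hge]
    · simp [hθ₀, hhd]
    · simp [hθ₁, hhe]
  let k : F₂ ⋊[φ] V₄ →* H := SemidirectProduct.lift _ _ (equivariant_of_eq_top hQ)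
  have hZ : equivariantSubgroup ψ (zpowersHom H t) k = ⊤ := by
    apply semidirect_subgroup_eq_top <;> rw [mem_equivariantSubgroup] <;> ext
    · simp [k, hψ, hdt]
    · simp [k, hψ, het]
    · simp [k, hψ, hgt]
    · simp [k, hψ, hht]
  refine ⟨SemidirectProduct.lift _ k (equivariant_of_eq_top hZ), ?_⟩
  simp [k]

end Helpers

/-- The presented group is isomorphic to `ℤ ⋊ Q`, where `Q = F₂ ⋊ V₄` with
`(1,0) ∈ V₄` acting on `F₂` by `ι` and `(0,1) ∈ V₄` acting by `θ`, and an
element of `Q` acts on `ℤ` trivially if the second `ℤ/2`-coordinate of its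
`V₄`-component is trivial and by negation otherwise.  The isomorphism carries
`a` to the generator `1` of `ℤ`, `D₁'` to `x`, `D₂'` to `y`, `h₁` to `(1,0)`
and `h₂` to `(0,1)`.  In particular, the image of `a` has infinite order. -/
theorem structure_of_presented_group
    (φ : V₄ →* MulAut F₂)
    (hι₀ : φ (Multiplicative.ofAdd (1, 0)) (FreeGroup.of 0) = (FreeGroup.of 0)⁻¹)
    (hι₁ : φ (Multiplicative.ofAdd (1, 0)) (FreeGroup.of 1) = (FreeGroup.of 1)⁻¹)
    (hθ₀ : φ (Multiplicative.ofAdd (0, 1)) (FreeGroup.of 0) = (FreeGroup.of 1)⁻¹)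
    (hθ₁ : φ (Multiplicative.ofAdd (0, 1)) (FreeGroup.of 1) = (FreeGroup.of 0)⁻¹)
    (ψ : (F₂ ⋊[φ] V₄) →* MulAut (Multiplicative ℤ))
    (hψ : ∀ (q : F₂ ⋊[φ] V₄) (z : Multiplicative ℤ),
      ψ q z = if (Multiplicative.toAdd q.right).2 = 0 then z else z⁻¹) :
    (∃ e : PresentedGroup rels ≃* Multiplicative ℤ ⋊[ψ] (F₂ ⋊[φ] V₄),
      e (PresentedGroup.of 4) = SemidirectProduct.inl (Multiplicative.ofAdd 1) ∧
      e (PresentedGroup.of 0) =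
        SemidirectProduct.inr (SemidirectProduct.inl (FreeGroup.of 0)) ∧
      e (PresentedGroup.of 1) =
        SemidirectProduct.inr (SemidirectProduct.inl (FreeGroup.of 1)) ∧
      e (PresentedGroup.of 2) =
        SemidirectProduct.inr (SemidirectProduct.inr (Multiplicative.ofAdd (1, 0))) ∧
      e (PresentedGroup.of 3) =
        SemidirectProduct.inr (SemidirectProduct.inr (Multiplicative.ofAdd (0, 1)))) ∧
    ¬ IsOfFinOrder (PresentedGroup.of (rels := rels) 4) := by
  have hone : ∀ v : V₄, v ^ 2 = 1 := by decide
  let gens : Fin 5 → Multiplicative ℤ ⋊[ψ] (F₂ ⋊[φ] V₄) :=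
    ![.inr (.inl (.of 0)), .inr (.inl (.of 1)), .inr (.inr (.ofAdd (1, 0))),
      .inr (.inr (.ofAdd (0, 1))), .inl (.ofAdd 1)]
  have hgens : ∀ r ∈ rels, FreeGroup.lift gens r = 1 := by
    have hφ (v : V₄) (n : F₂) : (SemidirectProduct.inr v * SemidirectProduct.inl n *
        (SemidirectProduct.inr v)⁻¹ : F₂ ⋊[φ] V₄) = SemidirectProduct.inl (φ v n) := by
      rw [SemidirectProduct.inl_aut, map_inv]
    have hψ' (q : F₂ ⋊[φ] V₄) (z : Multiplicative ℤ) :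
        (SemidirectProduct.inr q * SemidirectProduct.inl z * (SemidirectProduct.inr q)⁻¹ :
          Multiplicative ℤ ⋊[ψ] (F₂ ⋊[φ] V₄)) = SemidirectProduct.inl (ψ q z) := by
      rw [SemidirectProduct.inl_aut, map_inv]
    rintro r (rfl | rfl | rfl | rfl | rfl | rfl | rfl | rfl | rfl | rfl) <;>
      simp only [D₁', D₂', h₁, h₂, a, map_mul, map_inv, map_pow, FreeGroup.lift_apply_of, gens,
        Matrix.cons_val]
    · simp only [← map_pow, hone, map_one]
    · simp only [← map_pow, hone, map_one]
    · simp only [← map_mul, ← map_inv, mul_comm]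
      simp
    · simp only [← map_mul, ← map_inv (SemidirectProduct.inr (φ := ψ)), hφ, hι₀]; simp
    · simp only [← map_mul, ← map_inv (SemidirectProduct.inr (φ := ψ)), hφ, hι₁]; simp
    · simp only [← map_mul, ← map_inv (SemidirectProduct.inr (φ := ψ)), hφ, hθ₀]; simp
    all_goals rw [hψ', hψ]; simp
  have rel {r : FreeGroup (Fin 5)} (hr : r ∈ rels) : PresentedGroup.mk rels r = 1 :=
    PresentedGroup.one_of_mem hr
  have r₁ := rel (r := h₁ ^ 2) (by simp [rels])
  have r₂ := rel (r := h₂ ^ 2) (by simp [rels])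
  have r₃ := rel (r := h₁ * h₂ * (h₂ * h₁)⁻¹) (by simp [rels])
  have r₄ := rel (r := h₁ * D₁' * h₁⁻¹ * D₁') (by simp [rels])
  have r₅ := rel (r := h₁ * D₂' * h₁⁻¹ * D₂') (by simp [rels])
  have r₆ := rel (r := h₂ * D₁' * h₂⁻¹ * D₂') (by simp [rels])
  have r₇ := rel (r := h₁ * a * h₁⁻¹ * a⁻¹) (by simp [rels])
  have r₈ := rel (r := h₂ * a * h₂⁻¹ * a) (by simp [rels])
  have r₉ := rel (r := D₁' * a * D₁'⁻¹ * a⁻¹) (by simp [rels])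
  have r₁₀ := rel (r := D₂' * a * D₂'⁻¹ * a⁻¹) (by simp [rels])
  simp only [map_mul, map_inv, map_pow, mul_eq_one_iff_eq_inv, inv_inv]
    at r₁ r₂ r₃ r₄ r₅ r₆ r₇ r₈ r₉ r₁₀
  obtain ⟨back, b₄, b₀, b₁, b₂, b₃⟩ :=
    exists_hom_of_relations hι₀ hι₁ hθ₀ hθ₁ hψ r₁ r₂ r₃ r₄ r₅ r₆ r₇ r₈ r₉ r₁₀
  let forth : PresentedGroup rels →* Multiplicative ℤ ⋊[ψ] (F₂ ⋊[φ] V₄) :=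
    PresentedGroup.toGroup hgens
  have forth_of (i : Fin 5) : forth (PresentedGroup.of i) = gens i :=
    PresentedGroup.toGroup.of hgens
  let e : PresentedGroup rels ≃* Multiplicative ℤ ⋊[ψ] (F₂ ⋊[φ] V₄) := forth.toMulEquiv back
    (by
      refine PresentedGroup.ext fun i => ?_
      rw [MonoidHom.comp_apply, forth_of]
      fin_cases i
      exacts [b₀, b₁, b₂, b₃, b₄])
    (by
      refine SemidirectProduct.hom_ext ?_ (SemidirectProduct.hom_ext ?_ (klein_hom_ext ?_ ?_))
      · ext1
        exact (congrArg forth b₄).trans (forth_of 4)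
      · ext i : 1
        fin_cases i
        · exact (congrArg forth b₀).trans (forth_of 0)
        · exact (congrArg forth b₁).trans (forth_of 1)
      · exact (congrArg forth b₂).trans (forth_of 2)
      · exact (congrArg forth b₃).trans (forth_of 3))
  refine ⟨⟨e, forth_of 4, forth_of 0, forth_of 1, forth_of 2, forth_of 3⟩, fun h => ?_⟩
  have h_inl : IsOfFinOrder (gens 4) := forth_of 4 ▸ forth.isOfFinOrder h
  have h_one : IsOfFinOrder (Multiplicative.ofAdd (1 : ℤ)) :=
    (SemidirectProduct.inl_injective (φ := ψ)).isOfFinOrder_iff.1 h_inl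
  obtain ⟨n, hn, h_pow⟩ := isOfFinOrder_iff_pow_eq_one.1 h_one
  rw [← ofAdd_nsmul, ofAdd_eq_one, nsmul_one] at h_pow
  omega

end Stmt3
end

section
/- Let H be the presented group on generators D₁, D₂, g₁, g₂ with relations g₁² = 1, g₂² = 1, g₁g₂ = g₂g₁, g₁D₁g₁⁻¹ = D₁⁻¹, g₁D₂g₁⁻¹ = D₂⁻¹, g₂D₁g₂⁻¹ = D₂. Let V₄ = ℤ/2 × ℤ/2 act on the free group F₂ on generators x, y by letting (1,0) act by the automorphism ι (ι(x) = x⁻¹, ι(y) = y⁻¹) and (0,1) act by the swap automorphism σ (σ(x) = y, σ(y) = x). Then H is isomorphic to the semidirect product F₂ ⋊ V₄, via an isomorphism carrying D₁ to x, D₂ to y, g₁ to (1,0) ∈ V₄, and g₂ to (0,1) ∈ V₄. In particular, the images of D₁ and D₂ in H freely generate a free subgroup of rank 2. -/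
namespace Stmt4

/-- Generators: `0 ↦ D₁`, `1 ↦ D₂`, `2 ↦ g₁`, `3 ↦ g₂`. -/
def D₁ : FreeGroup (Fin 4) := FreeGroup.of 0
def D₂ : FreeGroup (Fin 4) := FreeGroup.of 1
def g₁ : FreeGroup (Fin 4) := FreeGroup.of 2
def g₂ : FreeGroup (Fin 4) := FreeGroup.of 3

/-- The relators of the presentation of `mcg*(F)` for the twice-marked Möbius
band (proof of Lemma 3.1(1)).  Note `g₂D₁g₂⁻¹ = D₂` (with no inverse). -/
def rels : Set (FreeGroup (Fin 4)) :=
  {g₁ ^ 2, g₂ ^ 2, g₁ * g₂ * (g₂ * g₁)⁻¹,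
   g₁ * D₁ * g₁⁻¹ * D₁, g₁ * D₂ * g₁⁻¹ * D₂, g₂ * D₁ * g₂⁻¹ * D₂⁻¹}

/-- The Klein four-group `V₄ = ℤ/2 × ℤ/2` (written multiplicatively). -/
abbrev V₄ := Multiplicative (ZMod 2 × ZMod 2)

/-- The free group `F₂` on two generators `x = of 0` and `y = of 1`. -/
abbrev F₂ := FreeGroup (Fin 2)

/-- The homomorphism out of `V₄` determined by two commuting involutions. -/
def V₄.lift {G : Type*} [Group G] (a b : G) (ha : a ^ 2 = 1) (hb : b ^ 2 = 1)
    (hab : a * b = b * a) : V₄ →* G where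
  toFun v := a ^ v.toAdd.1.val * b ^ v.toAdd.2.val
  map_one' := by simp
  map_mul' v w := by
    have key (c : G) (hc : c ^ 2 = 1) (m n : ZMod 2) :
        c ^ (m + n).val = c ^ m.val * c ^ n.val := by
      rw [ZMod.val_add, ← pow_add, ← pow_eq_pow_mod _ hc]
    have hcomm (m n : ℕ) : a ^ m * b ^ n = b ^ n * a ^ m :=
      (Commute.pow_pow (show Commute a b from hab) m n).eq
    simp only [toAdd_mul, Prod.fst_add, Prod.snd_add, key a ha, key b hb]
    simp only [mul_assoc, mul_left_cancel_iff]
    rw [← mul_assoc, hcomm, mul_assoc]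

@[simp]
theorem V₄.lift_ofAdd_one_zero {G : Type*} [Group G] (a b : G) (ha : a ^ 2 = 1)
    (hb : b ^ 2 = 1) (hab : a * b = b * a) :
    V₄.lift a b ha hb hab (Multiplicative.ofAdd (1, 0)) = a := by
  simp [V₄.lift, ZMod.val_one]

@[simp]
theorem V₄.lift_ofAdd_zero_one {G : Type*} [Group G] (a b : G) (ha : a ^ 2 = 1)
    (hb : b ^ 2 = 1) (hab : a * b = b * a) :
    V₄.lift a b ha hb hab (Multiplicative.ofAdd (0, 1)) = b := by
  simp [V₄.lift, ZMod.val_one]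

theorem V₄.closure_eq_top :
    Subgroup.closure {(Multiplicative.ofAdd (1, 0) : V₄), Multiplicative.ofAdd (0, 1)} = ⊤ := by
  have h₁ := Subgroup.subset_closure (Set.mem_insert (Multiplicative.ofAdd (1, 0) : V₄)
    {Multiplicative.ofAdd (0, 1)})
  have h₂ := Subgroup.subset_closure (Set.mem_insert_of_mem
    (Multiplicative.ofAdd (1, 0) : V₄) (Set.mem_singleton (Multiplicative.ofAdd (0, 1))))
  refine (Subgroup.eq_top_iff' _).2 fun v => ?_
  have hv : v = Multiplicative.ofAdd (1, 0) ^ v.toAdd.1.val *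
      Multiplicative.ofAdd (0, 1) ^ v.toAdd.2.val := by
    revert v; decide
  rw [hv]
  exact mul_mem (pow_mem h₁ _) (pow_mem h₂ _)

theorem V₄.hom_ext {G : Type*} [Group G] {f g : V₄ →* G}
    (h₁ : f (Multiplicative.ofAdd (1, 0)) = g (Multiplicative.ofAdd (1, 0)))
    (h₂ : f (Multiplicative.ofAdd (0, 1)) = g (Multiplicative.ofAdd (0, 1))) : f = g :=
  MonoidHom.eq_of_eqOn_dense V₄.closure_eq_top (by simp [Set.EqOn, h₁, h₂])

/-- A compatibility between actions and conjugation may be checked on generators of the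
acting group. -/
theorem comp_eq_conj_comp_of_closure_eq_top {N G H : Type*} [Group N] [Group G] [Group H]
    {φ : G →* MulAut N} (f : N →* H) (k : G →* H) {s : Set G} (hs : Subgroup.closure s = ⊤)
    (h : ∀ g ∈ s, f.comp (φ g).toMonoidHom = (MulAut.conj (k g)).toMonoidHom.comp f) (g : G) :
    f.comp (φ g).toMonoidHom = (MulAut.conj (k g)).toMonoidHom.comp f := by
  have h' : ∀ g ∈ s, ∀ n, f (φ g n) = k g * f n * (k g)⁻¹ := fun g hg n =>
    DFunLike.congr_fun (h g hg) n
  ext n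
  change f (φ g n) = k g * f n * (k g)⁻¹
  have hg : g ∈ Subgroup.closure s := hs ▸ Subgroup.mem_top g
  induction hg using Subgroup.closure_induction generalizing n with
  | mem g hg => exact h' g hg n
  | one => simp
  | mul a b _ _ iha ihb => simp [iha, ihb, mul_assoc]
  | inv a _ iha =>
    have := iha ((φ a)⁻¹ n)
    rw [MulAut.apply_inv_self] at this
    simp [this, mul_assoc]

theorem conj_eq_of_conj_eq_of_sq_eq_one {G : Type*} [Group G] {a b c : G} (ha : a ^ 2 = 1)
    (h : a * b * a⁻¹ = c) : a * c * a⁻¹ = b := by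
  have ha' : a⁻¹ = a := inv_eq_of_mul_eq_one_left (by rw [← sq, ha])
  calc a * c * a⁻¹ = a⁻¹ * c * a := by rw [ha']
    _ = b := by rw [← h]; group

theorem relations_presentedGroup :
    (PresentedGroup.of 2 : PresentedGroup rels) ^ 2 = 1 ∧
    (PresentedGroup.of 3 : PresentedGroup rels) ^ 2 = 1 ∧
    (PresentedGroup.of 2 * PresentedGroup.of 3 : PresentedGroup rels) =
      PresentedGroup.of 3 * PresentedGroup.of 2 ∧
    (PresentedGroup.of 2 * PresentedGroup.of 0 * (PresentedGroup.of 2)⁻¹ : PresentedGroup rels) =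
      (PresentedGroup.of 0)⁻¹ ∧
    (PresentedGroup.of 2 * PresentedGroup.of 1 * (PresentedGroup.of 2)⁻¹ : PresentedGroup rels) =
      (PresentedGroup.of 1)⁻¹ ∧
    (PresentedGroup.of 3 * PresentedGroup.of 0 * (PresentedGroup.of 3)⁻¹ : PresentedGroup rels) =
      PresentedGroup.of 1 := by
  have h : ∀ r ∈ rels, PresentedGroup.mk rels r = 1 := fun r hr =>
    PresentedGroup.one_of_mem hr
  refine ⟨h (g₁ ^ 2) ?_, h (g₂ ^ 2) ?_, mul_inv_eq_one.1 (h (g₁ * g₂ * (g₂ * g₁)⁻¹) ?_),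
    eq_inv_of_mul_eq_one_left (h (g₁ * D₁ * g₁⁻¹ * D₁) ?_),
    eq_inv_of_mul_eq_one_left (h (g₁ * D₂ * g₁⁻¹ * D₂) ?_),
    mul_inv_eq_one.1 (h (g₂ * D₁ * g₂⁻¹ * D₂⁻¹) ?_)⟩ <;> simp [rels]

/-- The presented group is isomorphic to `F₂ ⋊ V₄`, where `(1,0) ∈ V₄` acts on
`F₂` by `ι` (inverting both generators) and `(0,1) ∈ V₄` acts by the swap `σ`;
the isomorphism carries `D₁` to `x`, `D₂` to `y`, `g₁` to `(1,0)` and `g₂` to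
`(0,1)`.  In particular, the images of `D₁` and `D₂` freely generate a free
subgroup of rank 2. -/
theorem structure_of_presented_group
    (φ : V₄ →* MulAut F₂)
    (hι₀ : φ (Multiplicative.ofAdd (1, 0)) (FreeGroup.of 0) = (FreeGroup.of 0)⁻¹)
    (hι₁ : φ (Multiplicative.ofAdd (1, 0)) (FreeGroup.of 1) = (FreeGroup.of 1)⁻¹)
    (hσ₀ : φ (Multiplicative.ofAdd (0, 1)) (FreeGroup.of 0) = FreeGroup.of 1)
    (hσ₁ : φ (Multiplicative.ofAdd (0, 1)) (FreeGroup.of 1) = FreeGroup.of 0) :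
    (∃ e : PresentedGroup rels ≃* F₂ ⋊[φ] V₄,
      e (PresentedGroup.of 0) = SemidirectProduct.inl (FreeGroup.of 0) ∧
      e (PresentedGroup.of 1) = SemidirectProduct.inl (FreeGroup.of 1) ∧
      e (PresentedGroup.of 2) = SemidirectProduct.inr (Multiplicative.ofAdd (1, 0)) ∧
      e (PresentedGroup.of 3) = SemidirectProduct.inr (Multiplicative.ofAdd (0, 1))) ∧
    Function.Injective
      (FreeGroup.lift
          ![(PresentedGroup.of 0 : PresentedGroup rels), PresentedGroup.of 1] :
        FreeGroup (Fin 2) →* PresentedGroup rels) := by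
  obtain ⟨h₁, h₂, h₃, h₄, h₅, h₆⟩ := relations_presentedGroup
  have h₇ := conj_eq_of_conj_eq_of_sq_eq_one h₂ h₆
  let j : F₂ →* PresentedGroup rels := FreeGroup.lift ![PresentedGroup.of 0, PresentedGroup.of 1]
  let k : V₄ →* PresentedGroup rels := V₄.lift _ _ h₁ h₂ h₃
  have hjk : ∀ v, j.comp (φ v).toMonoidHom = (MulAut.conj (k v)).toMonoidHom.comp j := by
    refine comp_eq_conj_comp_of_closure_eq_top j k V₄.closure_eq_top ?_
    rintro v (rfl | rfl) <;> ext i <;> fin_cases i <;>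
      simp [j, k, hι₀, hι₁, hσ₀, hσ₁, h₄, h₅, h₆, h₇]
  let b : F₂ ⋊[φ] V₄ →* PresentedGroup rels := SemidirectProduct.lift j k hjk
  let t : Fin 4 → F₂ ⋊[φ] V₄ := ![.inl (.of 0), .inl (.of 1),
    .inr (Multiplicative.ofAdd (1, 0)), .inr (Multiplicative.ofAdd (0, 1))]
  have ht : ∀ r ∈ rels, FreeGroup.lift t r = 1 := by
    simp only [rels, D₁, D₂, g₁, g₂, Set.mem_insert_iff, Set.mem_singleton_iff,
      forall_eq_or_imp, forall_eq, map_mul, map_inv, map_pow, FreeGroup.lift_apply_of]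
    refine ⟨?_, ?_, ?_, ?_, ?_, ?_⟩
    · change SemidirectProduct.inr _ ^ 2 = 1
      rw [← map_pow, ← map_one SemidirectProduct.inr]
      rfl
    · change SemidirectProduct.inr _ ^ 2 = 1
      rw [← map_pow, ← map_one SemidirectProduct.inr]
      rfl
    · simp only [t, Matrix.cons_val, ← map_mul, mul_comm, mul_inv_cancel]
    · change SemidirectProduct.inr _ * SemidirectProduct.inl _ * (SemidirectProduct.inr _)⁻¹ *
        SemidirectProduct.inl _ = 1
      rw [← map_inv, ← SemidirectProduct.inl_aut, hι₀, map_inv, inv_mul_cancel]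
    · change SemidirectProduct.inr _ * SemidirectProduct.inl _ * (SemidirectProduct.inr _)⁻¹ *
        SemidirectProduct.inl _ = 1
      rw [← map_inv, ← SemidirectProduct.inl_aut, hι₁, map_inv, inv_mul_cancel]
    · change SemidirectProduct.inr _ * SemidirectProduct.inl _ * (SemidirectProduct.inr _)⁻¹ *
        (SemidirectProduct.inl _)⁻¹ = 1
      rw [← map_inv SemidirectProduct.inr, ← SemidirectProduct.inl_aut, hσ₀, mul_inv_cancel]
  let f : PresentedGroup rels →* F₂ ⋊[φ] V₄ := PresentedGroup.toGroup ht
  have hf (i : Fin 4) : f (PresentedGroup.of i) = t i := PresentedGroup.toGroup.of ht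
  have hbf : b.comp f = MonoidHom.id _ := by
    refine PresentedGroup.ext fun i => ?_
    rw [MonoidHom.comp_apply, hf]
    fin_cases i <;> simp [t, b, j, k]
  have hfj : f.comp j = SemidirectProduct.inl := by
    ext1 i
    fin_cases i <;> simp [j, hf, t]
  have hfb : f.comp b = MonoidHom.id _ := by
    refine SemidirectProduct.hom_ext ?_ ?_
    · rw [MonoidHom.comp_assoc, SemidirectProduct.lift_comp_inl, hfj, MonoidHom.id_comp]
    · rw [MonoidHom.comp_assoc, SemidirectProduct.lift_comp_inr]
      refine V₄.hom_ext ?_ ?_ <;> simp [k, hf, t]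
  refine ⟨⟨f.toMulEquiv b hbf hfb, hf 0, hf 1, hf 2, hf 3⟩, ?_⟩
  refine Function.Injective.of_comp (f := f) ?_
  rw [← MonoidHom.coe_comp]
  change Function.Injective (f.comp j)
  rw [hfj]
  exact SemidirectProduct.inl_injective

end Stmt4
end

section
/- Let G be the presented group on generators D₁, D₂, G₁, G₂, B with relations G₁² = 1, G₂² = 1, G₁G₂ = G₂G₁, G₁D₁G₁⁻¹ = D₁⁻¹, G₁D₂G₁⁻¹ = D₂⁻¹, G₂D₁G₂⁻¹ = D₂⁻¹, G₁BG₁⁻¹ = B⁻¹, G₂B = BG₂, D₁B = BD₁, D₂B = BD₂. Then the images of D₁ and D₂ in G freely generate a free subgroup of rank 2; that is, the homomorphism from the free group on two generators to G sending the generators to (the images of) D₁ and D₂ is injective. -/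
namespace Stmt5

/-- Generators: `0 ↦ D₁`, `1 ↦ D₂`, `2 ↦ G₁`, `3 ↦ G₂`, `4 ↦ B`. -/
def D₁ : FreeGroup (Fin 5) := FreeGroup.of 0
def D₂ : FreeGroup (Fin 5) := FreeGroup.of 1
def G₁ : FreeGroup (Fin 5) := FreeGroup.of 2
def G₂ : FreeGroup (Fin 5) := FreeGroup.of 3
def B : FreeGroup (Fin 5) := FreeGroup.of 4

/-- The relators of the presentation of `mcg(M)` for `M` satisfying condition
(M3-1-1) (Remark 3.4(1), with `D_m = B²` eliminated). -/
def rels : Set (FreeGroup (Fin 5)) :=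
  {G₁ ^ 2, G₂ ^ 2, G₁ * G₂ * (G₂ * G₁)⁻¹,
   G₁ * D₁ * G₁⁻¹ * D₁, G₁ * D₂ * G₁⁻¹ * D₂, G₂ * D₁ * G₂⁻¹ * D₂,
   G₁ * B * G₁⁻¹ * B,
   G₂ * B * (B * G₂)⁻¹, D₁ * B * (B * D₁)⁻¹, D₂ * B * (B * D₂)⁻¹}

/-- The endomorphism of a free group sending each generator `x_i` to `x_{σ i}⁻¹`. -/
def invHom {α : Type*} (σ : α → α) : FreeGroup α →* FreeGroup α :=
  FreeGroup.lift fun i => (FreeGroup.of (σ i))⁻¹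

@[simp]
theorem invHom_of {α : Type*} (σ : α → α) (i : α) :
    invHom σ (FreeGroup.of i) = (FreeGroup.of (σ i))⁻¹ := by
  simp [invHom]

theorem invHom_comp {α : Type*} (σ τ : α → α) :
    (invHom σ).comp (invHom τ) = FreeGroup.map (σ ∘ τ) := by
  ext i
  simp

theorem invHom_invHom {α : Type*} (σ τ : α → α) (x : FreeGroup α) :
    invHom σ (invHom τ x) = FreeGroup.map (σ ∘ τ) x :=
  DFunLike.congr_fun (invHom_comp σ τ) x

theorem invHom_involutive {α : Type*} {σ : α → α} (hσ : Function.Involutive σ) :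
    Function.Involutive (invHom σ) := fun x => by
  rw [invHom_invHom, hσ.comp_self, FreeGroup.map.id]

/-- For an involution `σ`, the endomorphism `invHom σ` as a permutation of the free group. -/
def invPerm {α : Type*} {σ : α → α} (hσ : Function.Involutive σ) : Equiv.Perm (FreeGroup α) :=
  (invHom_involutive hσ).toPerm

@[simp]
theorem invPerm_apply {α : Type*} {σ : α → α} (hσ : Function.Involutive σ) (x : FreeGroup α) :
    invPerm hσ x = invHom σ x :=
  rfl

@[simp]
theorem invPerm_inv {α : Type*} {σ : α → α} (hσ : Function.Involutive σ) :
    (invPerm hσ)⁻¹ = invPerm hσ :=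
  (invHom_involutive hσ).toPerm_symm

theorem id_involutive {α : Type*} : Function.Involutive (id : α → α) := fun _ => rfl

/-- Permutations of the free group on two generators satisfying the relations `rels`:
`D₁`, `D₂` act by left translation, `G₁`, `G₂` by automorphisms and `B` trivially. -/
def genPerm : Fin 5 → Equiv.Perm (FreeGroup (Fin 2)) :=
  ![MulAction.toPermHom (FreeGroup (Fin 2)) _ (FreeGroup.of 0),
    MulAction.toPermHom (FreeGroup (Fin 2)) _ (FreeGroup.of 1),
    invPerm id_involutive, invPerm (σ := Fin.rev) Fin.rev_involutive, 1]

theorem genPerm_rels : ∀ r ∈ rels, FreeGroup.lift genPerm r = 1 := by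
  intro r hr
  simp only [rels, Set.mem_insert_iff, Set.mem_singleton_iff] at hr
  rcases hr with rfl | rfl | rfl | rfl | rfl | rfl | rfl | rfl | rfl | rfl <;>
    ext1 x <;>
    simp [genPerm, D₁, D₂, G₁, G₂, B, sq, invHom_invHom, FreeGroup.map.comp,
      Fin.rev_involutive.comp_self]

/-- The action of the presented group on the free group on two generators. -/
def toPerm : PresentedGroup rels →* Equiv.Perm (FreeGroup (Fin 2)) :=
  PresentedGroup.toGroup genPerm_rels

theorem toPerm_comp_lift :
    toPerm.comp (FreeGroup.lift ![PresentedGroup.of 0, PresentedGroup.of 1]) =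
      MulAction.toPermHom (FreeGroup (Fin 2)) (FreeGroup (Fin 2)) := by
  ext i : 1
  fin_cases i <;> simp [toPerm, genPerm]

/-- The images of `D₁` and `D₂` in the presented group freely generate a free
subgroup of rank 2 (Theorem 3.3(1)). -/
theorem D₁_D₂_freely_generate :
    Function.Injective
      (FreeGroup.lift
          ![(PresentedGroup.of 0 : PresentedGroup rels), PresentedGroup.of 1] :
        FreeGroup (Fin 2) →* PresentedGroup rels) := by
  refine Function.Injective.of_comp (f := toPerm) ?_
  rw [← MonoidHom.coe_comp, toPerm_comp_lift]
  exact MulAction.toPerm_injective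

end Stmt5
end

section
/- Let G be the presented group on generators D₁', D₂', H₁, H₂, D_m, D_l with relations H₁² = 1, H₂² = 1, H₁H₂ = H₂H₁, H₁D₁'H₁⁻¹ = D₁'⁻¹, H₁D₂'H₁⁻¹ = D₂'⁻¹, H₂D₁'H₂⁻¹ = D₂'⁻¹, D_j'D_mD_j'⁻¹ = D_m and D_j'D_lD_j'⁻¹ = D_l for j = 1, 2, H₁D_mH₁⁻¹ = D_m⁻¹, H₂D_mH₂⁻¹ = D_m, H₁D_lH₁⁻¹ = D_l⁻¹, H₂D_lH₂⁻¹ = D_l⁻¹, and D_mD_l = D_lD_m. Then the subgroup of G generated by the images of D₁', D₂' and D_l is isomorphic to the direct product ℤ × F₂ of an infinite cyclic group and a free group of rank 2, via an isomorphism carrying D_l to (1, 1) and D_j' to (0, x_j) for j = 1, 2, where x₁, x₂ are free generators of F₂. In particular, D_l generates an infinite cyclic group commuting with D₁' and D₂', and D₁', D₂' freely generate a free subgroup of rank 2. -/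
namespace Stmt6

/-- Generators: `0 ↦ D₁'`, `1 ↦ D₂'`, `2 ↦ H₁`, `3 ↦ H₂`, `4 ↦ D_m`, `5 ↦ D_l`. -/
def D₁' : FreeGroup (Fin 6) := FreeGroup.of 0
def D₂' : FreeGroup (Fin 6) := FreeGroup.of 1
def H₁ : FreeGroup (Fin 6) := FreeGroup.of 2
def H₂ : FreeGroup (Fin 6) := FreeGroup.of 3
def Dm : FreeGroup (Fin 6) := FreeGroup.of 4
def Dl : FreeGroup (Fin 6) := FreeGroup.of 5

/-- The relators of the presentation of `mcg(M)` for `M` satisfying condition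
(M3-2-1) (Remark 3.4(2)). -/
def rels : Set (FreeGroup (Fin 6)) :=
  {H₁ ^ 2, H₂ ^ 2, H₁ * H₂ * (H₂ * H₁)⁻¹,
   H₁ * D₁' * H₁⁻¹ * D₁', H₁ * D₂' * H₁⁻¹ * D₂', H₂ * D₁' * H₂⁻¹ * D₂',
   D₁' * Dm * D₁'⁻¹ * Dm⁻¹, D₂' * Dm * D₂'⁻¹ * Dm⁻¹,
   D₁' * Dl * D₁'⁻¹ * Dl⁻¹, D₂' * Dl * D₂'⁻¹ * Dl⁻¹,
   H₁ * Dm * H₁⁻¹ * Dm, H₂ * Dm * H₂⁻¹ * Dm⁻¹,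
   H₁ * Dl * H₁⁻¹ * Dl, H₂ * Dl * H₂⁻¹ * Dl,
   Dm * Dl * (Dl * Dm)⁻¹}

/-- The image of `D₁'` in the presented group. -/
def d₁ : PresentedGroup rels := PresentedGroup.of 0
/-- The image of `D₂'` in the presented group. -/
def d₂ : PresentedGroup rels := PresentedGroup.of 1
/-- The image of `D_l` in the presented group. -/
def dl : PresentedGroup rels := PresentedGroup.of 5

/-- An endomorphism of a group whose square is the identity, as an automorphism. -/
def autOfInvolutive {N : Type*} [Group N] (f : N →* N)
    (hf : f.comp f = MonoidHom.id N) : MulAut N :=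
  f.toMulEquiv f hf hf

@[simp]
theorem autOfInvolutive_apply {N : Type*} [Group N] (f : N →* N)
    (hf : f.comp f = MonoidHom.id N) (n : N) : autOfInvolutive f hf n = f n :=
  rfl

/-- The automorphism of `F₂` inverting both generators. -/
def invertGens : MulAut (FreeGroup (Fin 2)) :=
  autOfInvolutive (FreeGroup.lift ![(FreeGroup.of 0)⁻¹, (FreeGroup.of 1)⁻¹]) (by
    ext i; fin_cases i <;> simp)

/-- The automorphism of `F₂` sending each generator to the inverse of the other one. -/
def swapInvertGens : MulAut (FreeGroup (Fin 2)) :=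
  autOfInvolutive (FreeGroup.lift ![(FreeGroup.of 1)⁻¹, (FreeGroup.of 0)⁻¹]) (by
    ext i; fin_cases i <;> simp)

@[simp]
theorem invertGens_of (i : Fin 2) : invertGens (FreeGroup.of i) = (FreeGroup.of i)⁻¹ := by
  fin_cases i <;> simp [invertGens]

@[simp]
theorem swapInvertGens_of_zero : swapInvertGens (FreeGroup.of 0) = (FreeGroup.of 1)⁻¹ := by
  simp [swapInvertGens]

@[simp]
theorem swapInvertGens_of_one : swapInvertGens (FreeGroup.of 1) = (FreeGroup.of 0)⁻¹ := by
  simp [swapInvertGens]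

theorem mulAut_freeGroup_ext {α : Type*} {a b : MulAut (FreeGroup α)}
    (h : ∀ i, a (FreeGroup.of i) = b (FreeGroup.of i)) : a = b :=
  MulEquiv.toMonoidHom_injective (FreeGroup.ext_hom _ _ h)

theorem invertGens_mul_self : invertGens * invertGens = 1 :=
  mulAut_freeGroup_ext fun i => by simp

theorem swapInvertGens_mul_self : swapInvertGens * swapInvertGens = 1 :=
  mulAut_freeGroup_ext fun i => by fin_cases i <;> simp

theorem invertGens_mul_swapInvertGens :
    invertGens * swapInvertGens = swapInvertGens * invertGens :=
  mulAut_freeGroup_ext fun i => by fin_cases i <;> simp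

/-- The automorphism of `ℤ × F` inverting the first factor and acting by `a` on the second. -/
def invProd {F : Type*} [Group F] (a : MulAut F) : MulAut (Multiplicative ℤ × F) :=
  (MulEquiv.inv (Multiplicative ℤ)).prodCongr a

@[simp]
theorem invProd_apply {F : Type*} [Group F] (a : MulAut F) (n : Multiplicative ℤ × F) :
    invProd a n = (n.1⁻¹, a n.2) :=
  rfl

theorem invProd_mul_self {F : Type*} [Group F] {a : MulAut F} (h : a * a = 1) :
    invProd a * invProd a = 1 := by
  ext n
  · simp
  · simpa using DFunLike.congr_fun h n.2

theorem invProd_comm {F : Type*} [Group F] {a b : MulAut F} (h : a * b = b * a) :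
    invProd a * invProd b = invProd b * invProd a := by
  ext n
  · simp
  · simpa using DFunLike.congr_fun h n.2

/-- The holomorph of a group. -/
abbrev Holomorph (N : Type*) [Group N] := N ⋊[MonoidHom.id (MulAut N)] MulAut N

theorem holomorph_conj {N : Type*} [Group N] (a : MulAut N) (n : N) :
    (SemidirectProduct.inr a * SemidirectProduct.inl n * (SemidirectProduct.inr a)⁻¹ :
      Holomorph N) = SemidirectProduct.inl (a n) := by
  rw [← map_inv, SemidirectProduct.inl_aut (φ := MonoidHom.id (MulAut N)) a n |>.symm]
  rfl

/-- Images of the generators in the holomorph of `ℤ × F₂`; `D_m` is killed. -/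
def holomorphGens : Fin 6 → Holomorph (Multiplicative ℤ × FreeGroup (Fin 2)) :=
  ![SemidirectProduct.inl (1, FreeGroup.of 0), SemidirectProduct.inl (1, FreeGroup.of 1),
    SemidirectProduct.inr (invProd invertGens), SemidirectProduct.inr (invProd swapInvertGens),
    1, SemidirectProduct.inl (Multiplicative.ofAdd 1, 1)]

theorem lift_holomorphGens_eq_one :
    ∀ r ∈ rels, FreeGroup.lift holomorphGens r = 1 := by
  intro r hr
  simp only [rels, Set.mem_insert_iff, Set.mem_singleton_iff] at hr
  rcases hr with rfl | rfl | rfl | rfl | rfl | rfl | rfl | rfl | rfl | rfl | rfl | rfl | rfl |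
    rfl | rfl <;>
  simp only [D₁', D₂', H₁, H₂, Dm, Dl, map_mul, map_inv, map_pow, FreeGroup.lift_apply_of,
    holomorphGens, Matrix.cons_val, holomorph_conj, mul_one, one_mul, mul_inv_cancel, inv_one]
  · rw [← map_pow, sq, invProd_mul_self invertGens_mul_self, map_one]
  · rw [← map_pow, sq, invProd_mul_self swapInvertGens_mul_self, map_one]
  · rw [mul_inv_eq_one, ← map_mul, ← map_mul, invProd_comm invertGens_mul_swapInvertGens]
  all_goals
    simp only [← map_mul, ← map_inv]
    simp [← Prod.one_eq_mk]

/-- The homomorphism from the presented group to the holomorph of `ℤ × F₂`. -/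
def toHolomorph : PresentedGroup rels →* Holomorph (Multiplicative ℤ × FreeGroup (Fin 2)) :=
  PresentedGroup.toGroup lift_holomorphGens_eq_one

theorem toHolomorph_d₁ : toHolomorph d₁ = SemidirectProduct.inl (1, FreeGroup.of 0) :=
  PresentedGroup.toGroup.of lift_holomorphGens_eq_one

theorem toHolomorph_d₂ : toHolomorph d₂ = SemidirectProduct.inl (1, FreeGroup.of 1) :=
  PresentedGroup.toGroup.of lift_holomorphGens_eq_one

theorem toHolomorph_dl :
    toHolomorph dl = SemidirectProduct.inl (Multiplicative.ofAdd 1, 1) :=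
  PresentedGroup.toGroup.of lift_holomorphGens_eq_one

theorem commute_dl_d₁ : Commute dl d₁ := by
  have h : PresentedGroup.mk rels (D₁' * Dl * D₁'⁻¹ * Dl⁻¹) = 1 :=
    PresentedGroup.one_of_mem (by simp [rels])
  rw [map_mul, map_inv, mul_inv_eq_one, map_mul, map_inv, mul_inv_eq_iff_eq_mul, map_mul] at h
  exact h.symm

theorem commute_dl_d₂ : Commute dl d₂ := by
  have h : PresentedGroup.mk rels (D₂' * Dl * D₂'⁻¹ * Dl⁻¹) = 1 :=
    PresentedGroup.one_of_mem (by simp [rels])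
  rw [map_mul, map_inv, mul_inv_eq_one, map_mul, map_inv, mul_inv_eq_iff_eq_mul, map_mul] at h
  exact h.symm

theorem commute_dl_lift (w : FreeGroup (Fin 2)) : Commute dl (FreeGroup.lift ![d₁, d₂] w) := by
  induction w using FreeGroup.induction_on with
  | C1 => simp
  | of i => fin_cases i <;> simp [commute_dl_d₁, commute_dl_d₂]
  | inv_of i h => rw [map_inv]; exact h.inv_right
  | mul x y hx hy => rw [map_mul]; exact hx.mul_right hy

/-- The homomorphism from `ℤ × F₂` sending `1 ∈ ℤ` to `dl` and the free generators to `d₁`, `d₂`. -/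
def ofIntTimesFree : Multiplicative ℤ × FreeGroup (Fin 2) →* PresentedGroup rels :=
  (zpowersHom _ dl).noncommCoprod (FreeGroup.lift ![d₁, d₂]) fun n w => by
    simpa using (commute_dl_lift w).zpow_left n.toAdd

theorem ofIntTimesFree_apply (n : Multiplicative ℤ) (w : FreeGroup (Fin 2)) :
    ofIntTimesFree (n, w) = dl ^ n.toAdd * FreeGroup.lift ![d₁, d₂] w :=
  rfl

theorem toHolomorph_ofIntTimesFree (p : Multiplicative ℤ × FreeGroup (Fin 2)) :
    toHolomorph (ofIntTimesFree p) = SemidirectProduct.inl p := by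
  obtain ⟨n, w⟩ := p
  have hw : toHolomorph (FreeGroup.lift ![d₁, d₂] w) = SemidirectProduct.inl (1, w) := by
    refine DFunLike.congr_fun (FreeGroup.ext_hom (toHolomorph.comp (FreeGroup.lift ![d₁, d₂]))
      (SemidirectProduct.inl.comp (MonoidHom.inr _ _)) fun i => ?_) w
    fin_cases i <;> simp [toHolomorph_d₁, toHolomorph_d₂]
  rw [ofIntTimesFree_apply, map_mul, map_zpow, toHolomorph_dl, hw, ← map_zpow, ← map_mul]
  simp [← ofAdd_zsmul]

theorem ofIntTimesFree_injective : Function.Injective ofIntTimesFree := fun p q h =>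
  SemidirectProduct.inl_injective (by
    rw [← toHolomorph_ofIntTimesFree, ← toHolomorph_ofIntTimesFree, h])

theorem range_ofIntTimesFree : ofIntTimesFree.range = Subgroup.closure {d₁, d₂, dl} := by
  apply le_antisymm
  · rintro _ ⟨⟨n, w⟩, rfl⟩
    rw [ofIntTimesFree_apply]
    refine mul_mem (zpow_mem (Subgroup.subset_closure (by simp)) _) ?_
    have h : (FreeGroup.lift ![d₁, d₂]).range ≤ Subgroup.closure {d₁, d₂, dl} := by
      rw [FreeGroup.range_lift_eq_closure]
      apply Subgroup.closure_mono
      rintro _ ⟨i, rfl⟩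
      fin_cases i <;> simp
    exact h ⟨w, rfl⟩
  · rw [Subgroup.closure_le]
    rintro _ (rfl | rfl | rfl)
    · exact ⟨(1, FreeGroup.of 0), by simp [ofIntTimesFree_apply]⟩
    · exact ⟨(1, FreeGroup.of 1), by simp [ofIntTimesFree_apply]⟩
    · exact ⟨(Multiplicative.ofAdd 1, 1), by simp [ofIntTimesFree_apply]⟩

/-- The subgroup `⟨D₁', D₂', D_l⟩` of the presented group is isomorphic to
`ℤ × F₂`, via an isomorphism carrying `D_l` to `(1, 1)` and `D_j'` to
`(0, x_j)`.  In particular `D_l` generates an infinite cyclic group commuting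
with `D₁'` and `D₂'`, and `D₁'`, `D₂'` freely generate a free subgroup of
rank 2 (Theorem 3.3(2)). -/
theorem subgroup_is_int_times_free :
    (∃ e : (Subgroup.closure {d₁, d₂, dl} : Subgroup (PresentedGroup rels)) ≃*
        Multiplicative ℤ × FreeGroup (Fin 2),
      e ⟨dl, Subgroup.subset_closure (by simp)⟩ = (Multiplicative.ofAdd 1, 1) ∧
      e ⟨d₁, Subgroup.subset_closure (by simp)⟩ = (1, FreeGroup.of 0) ∧
      e ⟨d₂, Subgroup.subset_closure (by simp)⟩ = (1, FreeGroup.of 1)) ∧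
    ¬ IsOfFinOrder dl ∧ dl * d₁ = d₁ * dl ∧ dl * d₂ = d₂ * dl ∧
    Function.Injective
      (FreeGroup.lift ![d₁, d₂] : FreeGroup (Fin 2) →* PresentedGroup rels) := by
  refine ⟨⟨((ofIntTimesFree.ofInjective ofIntTimesFree_injective).trans
    (MulEquiv.subgroupCongr range_ofIntTimesFree)).symm, ?_, ?_, ?_⟩,
    ?_, commute_dl_d₁, commute_dl_d₂, ?_⟩
  · rw [MulEquiv.symm_apply_eq]
    exact Subtype.ext (by simp [ofIntTimesFree_apply, MonoidHom.ofInjective_apply])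
  · rw [MulEquiv.symm_apply_eq]
    exact Subtype.ext (by simp [ofIntTimesFree_apply, MonoidHom.ofInjective_apply])
  · rw [MulEquiv.symm_apply_eq]
    exact Subtype.ext (by simp [ofIntTimesFree_apply, MonoidHom.ofInjective_apply])
  · rw [← injective_zpow_iff_not_isOfFinOrder]
    intro m n h
    have h' : ofIntTimesFree (Multiplicative.ofAdd m, 1) =
        ofIntTimesFree (Multiplicative.ofAdd n, 1) := by
      simpa [ofIntTimesFree_apply] using h
    simpa using ofIntTimesFree_injective h'
  · intro v w h
    have h' : ofIntTimesFree (1, v) = ofIntTimesFree (1, w) := by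
      simpa [ofIntTimesFree_apply] using h
    simpa using ofIntTimesFree_injective h'

end Stmt6
end

section
/- Let G be the presented group on generators D₁, D₂, g₁, g₂, b with relations g₁² = 1, g₂² = 1, g₁g₂ = g₂g₁, g₁D₁g₁⁻¹ = D₁⁻¹, g₁D₂g₁⁻¹ = D₂⁻¹, g₂D₁g₂⁻¹ = D₂⁻¹, b² = 1, bg₁ = g₁b, bg₂ = g₂b, bD₁ = D₁b, bD₂ = D₂b. Then the only element w of the subgroup of G generated by the images of D₁ and D₂ that commutes with the image of g₂ is the identity; equivalently, w g₂ w⁻¹ = g₂ with w ∈ ⟨D₁, D₂⟩ implies w = 1. -/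
namespace Stmt8

/-- Generators: `0 ↦ D₁`, `1 ↦ D₂`, `2 ↦ g₁`, `3 ↦ g₂`, `4 ↦ b`. -/
def D₁ : FreeGroup (Fin 5) := FreeGroup.of 0
def D₂ : FreeGroup (Fin 5) := FreeGroup.of 1
def g₁ : FreeGroup (Fin 5) := FreeGroup.of 2
def g₂ : FreeGroup (Fin 5) := FreeGroup.of 3
def b : FreeGroup (Fin 5) := FreeGroup.of 4

/-- The relators of the presentation of Lemma 3.1(1). -/
def rels : Set (FreeGroup (Fin 5)) :=
  {g₁ ^ 2, g₂ ^ 2, g₁ * g₂ * (g₂ * g₁)⁻¹,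
   g₁ * D₁ * g₁⁻¹ * D₁, g₁ * D₂ * g₁⁻¹ * D₂, g₂ * D₁ * g₂⁻¹ * D₂,
   b ^ 2, b * g₁ * (g₁ * b)⁻¹, b * g₂ * (g₂ * b)⁻¹,
   b * D₁ * (D₁ * b)⁻¹, b * D₂ * (D₂ * b)⁻¹}

/-- The endomorphism of a free group sending each generator `x` to the inverse of `σ x`. -/
def invMapHom {α : Type*} (σ : Equiv.Perm α) : FreeGroup α →* FreeGroup α :=
  FreeGroup.lift fun x => (FreeGroup.of (σ x))⁻¹

/-- The automorphism of a free group sending each generator `x` to the inverse of `σ x`. -/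
def invMapAut {α : Type*} (σ : Equiv.Perm α) : MulAut (FreeGroup α) :=
  MonoidHom.toMulEquiv (invMapHom σ) (invMapHom σ⁻¹)
    (by ext x; simp [invMapHom]) (by ext x; simp [invMapHom])

@[simp]
theorem invMapAut_of {α : Type*} (σ : Equiv.Perm α) (x : α) :
    invMapAut σ (FreeGroup.of x) = (FreeGroup.of (σ x))⁻¹ := by
  simp [invMapAut, invMapHom]

theorem invMapAut_mul {α : Type*} (σ τ : Equiv.Perm α) (u : FreeGroup α) :
    invMapAut σ (invMapAut τ u) = FreeGroup.map (σ * τ) u := by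
  have h : ((invMapAut σ * invMapAut τ : MulAut (FreeGroup α)) : FreeGroup α →* FreeGroup α) =
      FreeGroup.map (σ * τ) := by
    ext x; simp
  exact DFunLike.congr_fun h u

theorem invMapAut_mk {α : Type*} (σ : Equiv.Perm α) (L : List (α × Bool)) :
    invMapAut σ (FreeGroup.mk L) = FreeGroup.mk (L.map fun p => (σ p.1, !p.2)) := by
  induction L with
  | nil => exact map_one _
  | cons p L ih =>
    have hcons (q : α × Bool) (M : List (α × Bool)) :
        FreeGroup.mk (q :: M) = FreeGroup.mk [q] * FreeGroup.mk M := by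
      rw [FreeGroup.mul_mk, List.singleton_append]
    rw [hcons, map_mul, ih, List.map_cons, hcons (σ p.1, !p.2)]
    congr 1
    obtain ⟨x, _ | _⟩ := p
    · have h : FreeGroup.mk [(x, false)] = (FreeGroup.of x)⁻¹ := rfl
      rw [h, map_inv, invMapAut_of, inv_inv]
      rfl
    · exact invMapAut_of σ x

/-- An automorphism mapping every generator to the inverse of a generator has no nontrivial fixed
points, since it flips the sign of the first letter of every reduced word. -/
theorem eq_one_of_invMapAut_eq_self {α : Type*} [DecidableEq α] (σ : Equiv.Perm α)
    {u : FreeGroup α} (hu : invMapAut σ u = u) : u = 1 := by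
  have hred : FreeGroup.IsReduced (u.toWord.map fun p => (σ p.1, !p.2)) := by
    have h : FreeGroup.IsReduced u.toWord := FreeGroup.isReduced_toWord
    unfold FreeGroup.IsReduced at h ⊢
    rw [List.isChain_map]
    exact h.imp fun p q hpq hσ => by rw [hpq (σ.injective hσ)]
  have hw : u.toWord.map (fun p => (σ p.1, !p.2)) = u.toWord := by
    conv_rhs => rw [← hu, ← FreeGroup.mk_toWord (x := u), invMapAut_mk, FreeGroup.toWord_mk]
    exact (FreeGroup.isReduced_iff_reduce_eq.1 hred).symm
  rw [← FreeGroup.toWord_eq_nil_iff]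
  cases h : u.toWord with
  | nil => rfl
  | cons p L => simp [h, Prod.ext_iff] at hw

/-- The images of the generators in the holomorph of the free group of rank two. -/
def holomorphGen : Fin 5 →
    FreeGroup (Fin 2) ⋊[MonoidHom.id (MulAut (FreeGroup (Fin 2)))] MulAut (FreeGroup (Fin 2)) :=
  ![SemidirectProduct.inl (FreeGroup.of 0), SemidirectProduct.inl (FreeGroup.of 1),
    SemidirectProduct.inr (invMapAut 1), SemidirectProduct.inr (invMapAut (Equiv.swap 0 1)), 1]

theorem lift_holomorphGen_eq_one : ∀ r ∈ rels, FreeGroup.lift holomorphGen r = 1 := by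
  have hconj (σ : Equiv.Perm (Fin 2)) (x : Fin 2) :
      (SemidirectProduct.inr (invMapAut σ) * SemidirectProduct.inl (FreeGroup.of x) *
        (SemidirectProduct.inr (invMapAut σ))⁻¹ * SemidirectProduct.inl (FreeGroup.of (σ x)) :
        FreeGroup (Fin 2) ⋊[MonoidHom.id (MulAut (FreeGroup (Fin 2)))]
          MulAut (FreeGroup (Fin 2))) = 1 := by
    rw [← map_inv, ← SemidirectProduct.inl_aut, ← map_mul]
    simp
  have hsq (σ : Equiv.Perm (Fin 2)) (hσ : σ * σ = 1) : invMapAut σ ^ 2 = 1 := by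
    ext u : 1
    rw [pow_two, MulAut.mul_apply, invMapAut_mul, hσ]
    exact FreeGroup.map.id u
  have hcomm : invMapAut (1 : Equiv.Perm (Fin 2)) * invMapAut (Equiv.swap 0 1) =
      invMapAut (Equiv.swap 0 1) * invMapAut 1 := by
    ext u : 1
    simp only [MulAut.mul_apply, invMapAut_mul, one_mul, mul_one]
  rintro r (rfl | rfl | rfl | rfl | rfl | rfl | rfl | rfl | rfl | rfl | rfl) <;>
    simp only [D₁, D₂, g₁, g₂, b, map_mul, map_pow, map_inv, FreeGroup.lift_apply_of]
  · change SemidirectProduct.inr _ ^ 2 = _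
    rw [← map_pow, hsq _ (one_mul 1), map_one]
  · change SemidirectProduct.inr _ ^ 2 = _
    rw [← map_pow, hsq _ (Equiv.swap_mul_self 0 1), map_one]
  · rw [mul_inv_eq_one]
    change SemidirectProduct.inr _ * SemidirectProduct.inr _ =
      SemidirectProduct.inr _ * SemidirectProduct.inr _
    rw [← map_mul, hcomm, map_mul]
  · exact hconj 1 0
  · exact hconj 1 1
  · exact hconj (Equiv.swap 0 1) 0
  all_goals simp [holomorphGen]

/-- The only element of the subgroup `⟨D₁, D₂⟩` of the presented group that
commutes with (the image of) `g₂` is the identity. -/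
theorem centralizer_of_g₂_in_D₁_D₂_is_trivial :
    ∀ w ∈ Subgroup.closure
        {(PresentedGroup.of 0 : PresentedGroup rels), PresentedGroup.of 1},
      w * PresentedGroup.of 3 * w⁻¹ = PresentedGroup.of 3 → w = 1 := by
  intro w hw hcomm
  let f : FreeGroup (Fin 2) →* PresentedGroup rels :=
    FreeGroup.lift ![PresentedGroup.of 0, PresentedGroup.of 1]
  let F := PresentedGroup.toGroup lift_holomorphGen_eq_one
  have hf : F.comp f = SemidirectProduct.inl := by
    ext1 i
    fin_cases i <;> simp [f, F, holomorphGen]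
  obtain ⟨u, rfl⟩ : w ∈ f.range := by
    rwa [FreeGroup.range_lift_eq_closure, Matrix.range_cons_cons_empty]
  have hu : F (f u) = SemidirectProduct.inl u := DFunLike.congr_fun hf u
  have h3 : F (PresentedGroup.of 3) =
      SemidirectProduct.inr (invMapAut (Equiv.swap 0 1)) :=
    PresentedGroup.toGroup.of _
  have hF := congrArg (fun x => (F x).left) hcomm
  simp only [map_mul, map_inv, hu, h3] at hF
  rw [eq_one_of_invMapAut_eq_self (Equiv.swap 0 1) (u := u), map_one]
  exact (mul_inv_eq_one.1 (by simpa using hF)).symm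

end Stmt8
end

section
/- Let G be a group and d ∈ G an element of infinite order such that the cyclic subgroup ⟨d⟩ generated by d is normal in G, and let π : G → G/⟨d⟩ be the quotient homomorphism. Let τ ∈ G satisfy τdτ⁻¹ = d⁻¹, and let H be a subgroup of G. If the only element of π(H) that commutes with π(τ) in G/⟨d⟩ is the identity, then the only element of H that commutes with τ in G is the identity. -/
namespace Stmt9

/-- Let `d ∈ G` have infinite order with `⟨d⟩` normal in `G`, let
`π : G → G/⟨d⟩` be the quotient map, and let `τ ∈ G` satisfy `τdτ⁻¹ = d⁻¹`.
If the only element of `π(H)` commuting with `π(τ)` is the identity, then the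
only element of `H` commuting with `τ` is the identity. -/
theorem centralizer_trivial_of_quotient_centralizer_trivial
    {G : Type*} [Group G] (d : G) (hd : ¬ IsOfFinOrder d)
    [hn : (Subgroup.zpowers d).Normal]
    (τ : G) (hτ : τ * d * τ⁻¹ = d⁻¹) (H : Subgroup G)
    (hcent : ∀ x ∈ Subgroup.map (QuotientGroup.mk' (Subgroup.zpowers d)) H,
      x * QuotientGroup.mk' (Subgroup.zpowers d) τ =
        QuotientGroup.mk' (Subgroup.zpowers d) τ * x → x = 1) :
    ∀ h ∈ H, h * τ = τ * h → h = 1 := by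
  intro h hh hcomm
  have hmk : QuotientGroup.mk' (Subgroup.zpowers d) h = 1 :=
    hcent _ (Subgroup.mem_map_of_mem _ hh) (by rw [← map_mul, ← map_mul, hcomm])
  obtain ⟨n, rfl⟩ := Subgroup.mem_zpowers_iff.mp ((QuotientGroup.eq_one_iff h).mp hmk)
  have hinv : d ^ n = d ^ (-n) := by
    calc d ^ n = τ * d ^ n * τ⁻¹ := eq_mul_inv_of_mul_eq hcomm
      _ = d ^ (-n) := by rw [← conj_zpow, hτ, inv_zpow']
  have hn0 : n = -n := injective_zpow_iff_not_isOfFinOrder.mpr hd hinv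
  rw [show n = 0 by lia, zpow_zero]

end Stmt9
end

section
/- Let G be the presented group on generators D₁', D₂', H₁, H₂, D_m, D_l with relations H₁² = 1, H₂² = 1, H₁H₂ = H₂H₁, H₁D₁'H₁⁻¹ = D₁'⁻¹, H₁D₂'H₁⁻¹ = D₂'⁻¹, H₂D₁'H₂⁻¹ = D₂'⁻¹, D_j'D_mD_j'⁻¹ = D_m and D_j'D_lD_j'⁻¹ = D_l for j = 1, 2, H₁D_mH₁⁻¹ = D_m⁻¹, H₂D_mH₂⁻¹ = D_m, H₁D_lH₁⁻¹ = D_l⁻¹, H₂D_lH₂⁻¹ = D_l⁻¹, and D_mD_l = D_lD_m. Then the only element g of the subgroup of G generated by the images of D₁', D₂' and D_l that commutes with the image of H₂ is the identity; equivalently, g H₂ g⁻¹ = H₂ with g ∈ ⟨D₁', D₂', D_l⟩ implies g = 1. -/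
namespace Stmt12

/-- Generators: `0 ↦ D₁'`, `1 ↦ D₂'`, `2 ↦ H₁`, `3 ↦ H₂`, `4 ↦ D_m`, `5 ↦ D_l`. -/
def D₁' : FreeGroup (Fin 6) := FreeGroup.of 0
def D₂' : FreeGroup (Fin 6) := FreeGroup.of 1
def H₁ : FreeGroup (Fin 6) := FreeGroup.of 2
def H₂ : FreeGroup (Fin 6) := FreeGroup.of 3
def Dm : FreeGroup (Fin 6) := FreeGroup.of 4
def Dl : FreeGroup (Fin 6) := FreeGroup.of 5

/-- The relators of the presentation of `mcg(M)` for `M` satisfying condition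
(M3-2-1) (Remark 3.4(2)). -/
def rels : Set (FreeGroup (Fin 6)) :=
  {H₁ ^ 2, H₂ ^ 2, H₁ * H₂ * (H₂ * H₁)⁻¹,
   H₁ * D₁' * H₁⁻¹ * D₁', H₁ * D₂' * H₁⁻¹ * D₂', H₂ * D₁' * H₂⁻¹ * D₂',
   D₁' * Dm * D₁'⁻¹ * Dm⁻¹, D₂' * Dm * D₂'⁻¹ * Dm⁻¹,
   D₁' * Dl * D₁'⁻¹ * Dl⁻¹, D₂' * Dl * D₂'⁻¹ * Dl⁻¹,
   H₁ * Dm * H₁⁻¹ * Dm, H₂ * Dm * H₂⁻¹ * Dm⁻¹,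
   H₁ * Dl * H₁⁻¹ * Dl, H₂ * Dl * H₂⁻¹ * Dl,
   Dm * Dl * (Dl * Dm)⁻¹}

/-- The image of `D₁'` in the presented group. -/
def d₁ : PresentedGroup rels := PresentedGroup.of 0
/-- The image of `D₂'` in the presented group. -/
def d₂ : PresentedGroup rels := PresentedGroup.of 1
/-- The image of `D_l` in the presented group. -/
def dl : PresentedGroup rels := PresentedGroup.of 5
/-- The image of `H₂` in the presented group. -/
def h₂ : PresentedGroup rels := PresentedGroup.of 3

section LetterInversion

variable {α : Type*}

/-- The automorphism of a free group inverting each generator. -/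
def invGenerators : MulAut (FreeGroup α) :=
  MonoidHom.toMulEquiv (FreeGroup.lift fun a => (FreeGroup.of a)⁻¹)
    (FreeGroup.lift fun a => (FreeGroup.of a)⁻¹)
    (by ext; simp) (by ext; simp)

@[simp]
theorem invGenerators_of (a : α) : invGenerators (FreeGroup.of a) = (FreeGroup.of a)⁻¹ := by
  simp [invGenerators]

theorem invGenerators_mk (L : List (α × Bool)) :
    invGenerators (FreeGroup.mk L) = FreeGroup.mk (L.map fun p => (p.1, !p.2)) := by
  induction L with
  | nil => exact map_one _
  | cons p L ih =>
    have h (q : α × Bool) (M : List (α × Bool)) :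
        FreeGroup.mk (q :: M) = FreeGroup.mk [q] * FreeGroup.mk M := by
      rw [FreeGroup.mul_mk, List.singleton_append]
    rw [h, map_mul, ih, List.map_cons, h (p.1, !p.2)]
    congr 1
    obtain ⟨a, _ | _⟩ := p
    · change invGenerators (FreeGroup.of a)⁻¹ = FreeGroup.of a
      simp
    · exact invGenerators_of a

/-- An automorphism of a free group that sends each generator to the inverse of a different
generator has no nontrivial fixed points. -/
theorem eq_one_of_freeGroupCongr_invGenerators_eq (e : α ≃ α) (he : ∀ a, e a ≠ a)
    (w : FreeGroup α) (hw : FreeGroup.freeGroupCongr e (invGenerators w) = w) : w = 1 := by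
  classical
  have hred : FreeGroup.IsReduced (w.toWord.map fun p => (e p.1, !p.2)) := by
    have h : FreeGroup.IsReduced w.toWord := FreeGroup.isReduced_toWord
    rw [FreeGroup.IsReduced, List.isChain_map]
    exact h.imp fun p q hpq h => congrArg (! ·) (hpq (e.injective h))
  have key : w.toWord.map (fun p => (e p.1, !p.2)) = w.toWord := by
    conv_rhs => rw [← hw, ← FreeGroup.mk_toWord (x := w), invGenerators_mk]
    rw [FreeGroup.freeGroupCongr_apply, FreeGroup.map.mk, FreeGroup.toWord_mk, List.map_map]
    exact hred.reduce_eq.symm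
  rw [← FreeGroup.toWord_eq_nil_iff]
  cases h : w.toWord with
  | nil => rfl
  | cons p L =>
    rw [h, List.map_cons, List.cons.injEq] at key
    exact absurd (congrArg Prod.fst key.1) (he p.1)

end LetterInversion

/-- A model, `F₂ × ℤ`, of the subgroup generated by `d₁`, `d₂` and `dl`. -/
abbrev Model : Type := FreeGroup Bool × Multiplicative ℤ

/-- The action of `H₁` on the model. -/
def actH₁ : MulAut Model := invGenerators.prodCongr (MulEquiv.inv _)

/-- The action of `H₁ H₂` on the model: it swaps the two free generators. -/
def actSwap : MulAut Model :=
  (FreeGroup.freeGroupCongr Equiv.boolNot).prodCongr (MulEquiv.refl _)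

/-- The action of `H₂` on the model. -/
def actH₂ : MulAut Model := actSwap * actH₁

theorem actH₁_sq : actH₁ * actH₁ = 1 := by
  refine MulEquiv.ext fun x => Prod.ext ?_ (inv_inv x.2)
  change (invGenerators.toMonoidHom.comp invGenerators.toMonoidHom) x.1 = MonoidHom.id _ x.1
  congr 1
  ext
  simp

theorem actSwap_sq : actSwap * actSwap = 1 := by
  refine MulEquiv.ext fun x => Prod.ext ?_ rfl
  change FreeGroup.map not (FreeGroup.map not x.1) = x.1
  rw [FreeGroup.map.comp, Bool.involutive_not.comp_self, FreeGroup.map.id]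

theorem actH₁_mul_actSwap : actH₁ * actSwap = actSwap * actH₁ := by
  refine MulEquiv.ext fun x => Prod.ext ?_ rfl
  change (invGenerators.toMonoidHom.comp (FreeGroup.map not)) x.1 =
    ((FreeGroup.map not).comp invGenerators.toMonoidHom) x.1
  congr 1
  ext
  simp

theorem eq_one_of_actH₂_eq (x : Model) (hx : actH₂ x = x) : x = 1 := by
  obtain ⟨w, n⟩ := x
  obtain ⟨hw, hn⟩ := Prod.ext_iff.1 hx
  refine Prod.ext (eq_one_of_freeGroupCongr_invGenerators_eq Equiv.boolNot (by decide) w hw) ?_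
  change n⁻¹ = n at hn
  have := congrArg Multiplicative.toAdd hn
  rw [toAdd_inv] at this
  refine Multiplicative.toAdd.injective ?_
  change Multiplicative.toAdd n = 0
  lia

/-- The extension of the model by its automorphism group. -/
abbrev Target : Type := Model ⋊[MonoidHom.id (MulAut Model)] MulAut Model

open SemidirectProduct in
/-- The images of the six generators in the extension of the model. -/
def genImage : Fin 6 → Target :=
  ![inl (FreeGroup.of false, 1), inl (FreeGroup.of true, 1), inr actH₁, inr actH₂, 1,
    inl (1, Multiplicative.ofAdd 1)]

open SemidirectProduct in
theorem lift_genImage_eq_one : ∀ r ∈ rels, FreeGroup.lift genImage r = 1 := by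
  have h₁ : (inr actH₁ : Target) * inr actH₁ = 1 := by rw [← map_mul, actH₁_sq, map_one]
  have h₂ : (inr actH₂ : Target) * inr actH₂ = 1 := by
    rw [← map_mul, actH₂, mul_assoc, ← mul_assoc actH₁, actH₁_mul_actSwap, mul_assoc, actH₁_sq,
      mul_one, actSwap_sq, map_one]
  have h₁₂ : (inr actH₁ : Target) * inr actH₂ = inr actH₂ * inr actH₁ := by
    rw [← map_mul, ← map_mul, actH₂, ← mul_assoc, actH₁_mul_actSwap]
  have conj (φ : MulAut Model) (x : Model) : (inr φ : Target) * inl x * (inr φ)⁻¹ = inl (φ x) := by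
    rw [← map_inv, ← inl_aut]; rfl
  have comm (x y : Model) (h : x * y = y * x) :
      (inl x : Target) * inl y * (inl x)⁻¹ * (inl y)⁻¹ = 1 := by
    rw [← map_mul, h]; simp
  have hD₁ : actH₁ (.of false, 1) = (.of false, 1)⁻¹ :=
    Prod.ext (invGenerators_of _) inv_one
  have hD₂ : actH₁ (.of true, 1) = (.of true, 1)⁻¹ :=
    Prod.ext (invGenerators_of _) inv_one
  have hDl : actH₁ (1, .ofAdd 1) = (1, .ofAdd 1)⁻¹ :=
    Prod.ext ((map_one invGenerators).trans inv_one.symm) rfl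
  have kD₁ : actH₂ (.of false, 1) = (.of true, 1)⁻¹ := by
    rw [actH₂, MulAut.mul_apply, hD₁]; rfl
  have kDl : actH₂ (1, .ofAdd 1) = (1, .ofAdd 1)⁻¹ := by
    rw [actH₂, MulAut.mul_apply, hDl]; rfl
  rintro r (rfl | rfl | rfl | rfl | rfl | rfl | rfl | rfl | rfl | rfl | rfl | rfl | rfl | rfl | rfl)
    <;> simp only [map_mul, map_inv, map_pow, D₁', D₂', H₁, H₂, Dm, Dl, FreeGroup.lift_apply_of]
    <;> simp [genImage, pow_two, h₁, h₂, h₁₂, conj, comm, hD₁, hD₂, hDl, kD₁, kDl,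
      -Prod.inv_mk]

/-- The presented group acts through the extension of the model. -/
def toTarget : PresentedGroup rels →* Target :=
  PresentedGroup.toGroup lift_genImage_eq_one

theorem commute_dl (b : Bool) : Commute (cond b d₂ d₁) dl := by
  have h (x y : FreeGroup (Fin 6)) (hr : x * y * x⁻¹ * y⁻¹ ∈ rels) :
      Commute (PresentedGroup.mk rels x) (PresentedGroup.mk rels y) := by
    rw [← commutatorElement_eq_one_iff_commute]
    exact PresentedGroup.one_of_mem hr
  cases b
  · exact h D₁' Dl (by simp [rels])
  · exact h D₂' Dl (by simp [rels])

/-- The homomorphism from the model onto the subgroup generated by `d₁`, `d₂` and `dl`. -/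
def ofModel : Model →* PresentedGroup rels :=
  MonoidHom.noncommCoprod (FreeGroup.lift fun b => cond b d₂ d₁) (zpowersHom _ dl) (by
    intro w n
    rw [zpowersHom_apply]
    refine Commute.zpow_right ?_ _
    induction w using FreeGroup.induction_on with
    | C1 => simp
    | of b => simpa using commute_dl b
    | inv_of b h => simpa using h.inv_left
    | mul v w hv hw => simpa using hv.mul_left hw)

theorem toTarget_ofModel (x : Model) : toTarget (ofModel x) = SemidirectProduct.inl x := by
  have hl : (toTarget.comp ofModel).comp (MonoidHom.inl _ _) =
      SemidirectProduct.inl.comp (MonoidHom.inl _ _) := by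
    ext b : 1
    cases b <;> simp [ofModel, toTarget, genImage, d₁, d₂]
  have hr : (toTarget.comp ofModel).comp (MonoidHom.inr _ _) =
      SemidirectProduct.inl.comp (MonoidHom.inr _ _) := by
    ext : 1
    simp [ofModel, toTarget, genImage, dl]
  rw [← Prod.fst_mul_snd x, map_mul, map_mul, map_mul]
  exact congrArg₂ (· * ·) (DFunLike.congr_fun hl x.1) (DFunLike.congr_fun hr x.2)

theorem closure_le_range_ofModel : Subgroup.closure {d₁, d₂, dl} ≤ ofModel.range := by
  rw [Subgroup.closure_le]
  rintro _ (rfl | rfl | rfl)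
  · exact ⟨(.of false, 1), by simp [ofModel]⟩
  · exact ⟨(.of true, 1), by simp [ofModel]⟩
  · exact ⟨(1, .ofAdd 1), by simp [ofModel]⟩

/-- The only element of the subgroup `⟨D₁', D₂', D_l⟩` of the presented group
that commutes with (the image of) `H₂` is the identity. -/
theorem centralizer_of_H₂_is_trivial :
    ∀ g ∈ Subgroup.closure {d₁, d₂, dl}, g * h₂ * g⁻¹ = h₂ → g = 1 := by
  intro g hg h
  obtain ⟨x, rfl⟩ := closure_le_range_ofModel hg
  have hx := congrArg toTarget (mul_inv_eq_iff_eq_mul.1 h)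
  have hH₂ : toTarget h₂ = SemidirectProduct.inr actH₂ := PresentedGroup.toGroup.of _
  rw [map_mul, map_mul, toTarget_ofModel, hH₂] at hx
  have hfix : actH₂ x = x := by
    simpa using (congrArg SemidirectProduct.left hx).symm
  rw [eq_one_of_actH₂_eq x hfix, map_one]

end Stmt12
end
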